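/- arXiv:1807.02664 — 2 statements merged into one kernel-verified Lean document; each statement's English description precedes it below -/
import Mathlib

section
/- Let X be a complete, purely n-unrectifiable metric space with H^n(X) < ∞, and suppose that for H^n-almost every x in X one has liminf_{r→0} H^n(B(x,r))/r^n > 0. Then for every m ∈ ℕ, the set of all f in Lip_1(X,m) with H^n(f(X)) = 0 is residual (comeager) in Lip_1(X,m). -/
open MeasureTheory Metric Set Filter
open scoped ENNReal NNReal Topology

/-- An `H^n`-measurable set `E` in a metric space `X` is `n`-rectifiable if there are
measurable sets `F i ⊆ ℝ^n` and Lipschitz maps `f i : F i → X` such that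
`H^n (E \ ⋃ i, f i '' F i) = 0`. -/
def IsRectifiableSet (n : ℕ) {X : Type*} [MetricSpace X] [MeasurableSpace X] [BorelSpace X]
    (E : Set X) : Prop :=
  MeasurableSet E ∧
  ∃ (F : ℕ → Set (EuclideanSpace ℝ (Fin n))) (f : ℕ → EuclideanSpace ℝ (Fin n) → X),
    (∀ i, MeasurableSet (F i)) ∧ (∀ i, ∃ K : ℝ≥0, LipschitzOnWith K (f i) (F i)) ∧
    μH[n] (E \ ⋃ i, f i '' F i) = 0

/-- `Lip_1(X, m)`: the space of bounded `1`-Lipschitz functions `X → ℝ^m`, equipped with the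
supremum distance (as a subspace of bounded continuous functions). -/
def Lip1 (X : Type*) [MetricSpace X] (m : ℕ) : Type _ :=
  {f : BoundedContinuousFunction X (EuclideanSpace ℝ (Fin m)) // LipschitzWith 1 f}

noncomputable instance (X : Type*) [MetricSpace X] (m : ℕ) : MetricSpace (Lip1 X m) :=
  inferInstanceAs (MetricSpace {f : BoundedContinuousFunction X (EuclideanSpace ℝ (Fin m)) //
    LipschitzWith 1 f})

section Chains

variable {N : Type*}

/-- The total cost of the chain from `x` to `y` through the points of a list. -/
noncomputable def chainCost (c : N → N → ℝ) : N → List N → N → ℝ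
  | x, [], y => c x y
  | x, z :: l, y => c x z + chainCost c z l y

/-- The infimal cost of a finite chain from `x` to `y`. -/
noncomputable def chainDist (c : N → N → ℝ) (x y : N) : ℝ := ⨅ l : List N, chainCost c x l y

lemma chainCost_nonneg {c : N → N → ℝ} (hc : ∀ x y, 0 ≤ c x y) (l : List N) (x y : N) :
    0 ≤ chainCost c x l y := by
  induction l generalizing x with
  | nil => exact hc x y
  | cons z l ih => exact add_nonneg (hc x z) (ih z)

lemma chainDist_le_chainCost {c : N → N → ℝ} (hc : ∀ x y, 0 ≤ c x y) (l : List N) (x y : N) :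
    chainDist c x y ≤ chainCost c x l y :=
  ciInf_le ⟨0, by rintro _ ⟨l, rfl⟩; exact chainCost_nonneg hc l x y⟩ l

lemma chainDist_le {c : N → N → ℝ} (hc : ∀ x y, 0 ≤ c x y) (x y : N) :
    chainDist c x y ≤ c x y :=
  chainDist_le_chainCost hc [] x y

lemma chainDist_le_add {c : N → N → ℝ} (hc : ∀ x y, 0 ≤ c x y) (x y z : N) :
    chainDist c x z ≤ c x y + chainDist c y z := by
  rw [← sub_le_iff_le_add']
  refine le_ciInf fun l ↦ ?_
  have := chainDist_le_chainCost hc (y :: l) x z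
  rw [chainCost] at this
  linarith

lemma chainDist_le_chainCost_add {c : N → N → ℝ} (hc : ∀ x y, 0 ≤ c x y) (l : List N)
    (x y z : N) : chainDist c x z ≤ chainCost c x l y + chainDist c y z := by
  induction l generalizing x with
  | nil => exact chainDist_le_add hc x y z
  | cons w l ih =>
    have h₁ := chainDist_le_add hc x w z
    have h₂ := ih w
    rw [chainCost]
    linarith

lemma chainDist_triangle {c : N → N → ℝ} (hc : ∀ x y, 0 ≤ c x y) (x y z : N) :
    chainDist c x z ≤ chainDist c x y + chainDist c y z := by
  rw [← sub_le_iff_le_add]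
  refine le_ciInf fun l ↦ ?_
  linarith [chainDist_le_chainCost_add hc l x y z]

lemma chainDist_comm {c : N → N → ℝ} (hc : ∀ x y, 0 ≤ c x y) (hs : ∀ x y, c x y = c y x)
    (x y : N) : chainDist c x y = chainDist c y x := by
  have key : ∀ (l : List N) (x y : N), chainDist c y x ≤ chainCost c x l y := by
    intro l
    induction l with
    | nil => intro x y; rw [chainCost, hs]; exact chainDist_le hc y x
    | cons z l ih =>
      intro x y
      rw [chainCost]
      have h₁ := chainDist_triangle hc y z x
      have h₂ := chainDist_le hc z x
      have h₃ := ih z y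
      rw [hs x z]
      linarith
  exact le_antisymm (le_ciInf fun l ↦ key l y x) (le_ciInf fun l ↦ key l x y)

lemma le_chainDist {c ρ : N → N → ℝ} (hρ : ∀ x y, ρ x y ≤ c x y)
    (ht : ∀ x y z, ρ x z ≤ ρ x y + ρ y z) (x y : N) : ρ x y ≤ chainDist c x y := by
  refine le_ciInf fun l ↦ ?_
  induction l generalizing x with
  | nil => exact hρ x y
  | cons z l ih =>
    rw [chainCost]
    linarith [ht x z y, hρ x z, ih z]

lemma chainDist_mono {c c' : N → N → ℝ} (hc : ∀ x y, 0 ≤ c x y) (h : ∀ x y, c x y ≤ c' x y)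
    (x y : N) : chainDist c x y ≤ chainDist c' x y :=
  le_chainDist (fun x y ↦ (chainDist_le hc x y).trans (h x y)) (chainDist_triangle hc) x y

/-- A chain from near `a` to `b` either passes through a point away from `a` and `b`, or jumps
from a neighbourhood of `a` to a neighbourhood of `b`. -/
lemma exists_intermediate_or_jump {N : Type*} [PseudoMetricSpace N] {c : N → N → ℝ}
    (hc : ∀ x y, 0 ≤ c x y) {a b : N} {κ : ℝ} (hκ : 0 < κ) (l : List N) (x : N)
    (hx : dist a x < κ) :
    (∃ z, κ ≤ dist a z ∧ κ ≤ dist b z ∧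
      chainDist c x z + chainDist c z b ≤ chainCost c x l b) ∨
    ∃ x' y', dist a x' < κ ∧ dist b y' < κ ∧ c x' y' ≤ chainCost c x l b := by
  induction l generalizing x with
  | nil => exact Or.inr ⟨x, b, hx, by simpa using hκ, le_rfl⟩
  | cons z l ih =>
    have h0 := chainCost_nonneg hc l z b
    have hxz := hc x z
    rw [chainCost]
    by_cases haz : dist a z < κ
    · rcases ih z haz with ⟨w, h₁, h₂, h₃⟩ | ⟨x', y', h₁, h₂, h₃⟩
      · refine Or.inl ⟨w, h₁, h₂, ?_⟩
        linarith [chainDist_le_add hc x z w]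
      · exact Or.inr ⟨x', y', h₁, h₂, by linarith⟩
    · by_cases hbz : dist b z < κ
      · exact Or.inr ⟨x, z, hx, hbz, by linarith⟩
      · refine Or.inl ⟨z, not_lt.1 haz, not_lt.1 hbz, ?_⟩
        linarith [chainDist_le hc x z, chainDist_le_chainCost hc l z b]

end Chains

section Fragments

/-- A function on a compact subset of the line whose slope is at most `lam` across each gap and,
infinitesimally to the right, at almost every point, has total increment at most `lam * T`. -/
lemma sub_le_mul_of_ae_slope_le {F : Set ℝ} (hF : IsCompact F) {v : ℝ → ℝ}
    (hv : LipschitzOnWith 1 v F) {T lam : ℝ} (h0 : (0 : ℝ) ∈ F) (hT : T ∈ F)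
    (hFT : F ⊆ Icc 0 T) (hlam : 0 ≤ lam)
    (hae : ∀ᵐ t, t ∈ F → ∀ ε > 0, ∀ᶠ s in 𝓝[F ∩ Ioi t] t, v s - v t ≤ (lam + ε) * (s - t))
    (hgap : ∀ t ∈ F, ∀ t' ∈ F, t < t' → F ∩ Ioo t t' = ∅ → v t' - v t ≤ lam * (t' - t)) :
    v T - v 0 ≤ lam * T := by
  have hT0 : 0 ≤ T := (hFT h0).2
  refine le_of_forall_pos_le_add fun ε₀ hε₀ ↦ ?_
  obtain ⟨ε, hε, hεT⟩ : ∃ ε > 0, ε * T + ε ≤ ε₀ :=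
    ⟨ε₀ / (T + 1), by positivity, by field_simp; exact le_rfl⟩
  rw [ae_iff] at hae
  obtain ⟨O, hZO, hO, hOvol⟩ := exists_isOpen_lt_of_lt _ (ENNReal.ofReal ε)
    (hae.symm ▸ ENNReal.ofReal_pos.2 hε : volume _ < ENNReal.ofReal ε)
  have hfin : ∀ s, volume (O ∩ Icc 0 s) ≠ ∞ := fun s ↦
    ((measure_mono inter_subset_left).trans_lt (hOvol.trans ENNReal.ofReal_lt_top)).ne
  set w : ℝ → ℝ := fun s ↦ (volume (O ∩ Icc 0 s)).toReal with hw
  have wmono : Monotone w := fun s t hst ↦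
    ENNReal.toReal_mono (hfin t) (measure_mono (by gcongr))
  have wlip : ∀ s t, s ≤ t → w t ≤ w s + (t - s) := by
    intro s t hst
    have : volume (O ∩ Icc 0 t) ≤ volume (O ∩ Icc 0 s) + ENNReal.ofReal (t - s) := by
      rw [← Real.volume_Ioc]
      refine (measure_mono ?_).trans (measure_union_le _ _)
      rintro x ⟨hx, hx0, hxt⟩
      rcases le_or_gt x s with h | h
      · exact Or.inl ⟨hx, hx0, h⟩
      · exact Or.inr ⟨h, hxt⟩
    have h2 := ENNReal.toReal_mono (ENNReal.add_ne_top.2 ⟨hfin s, ENNReal.ofReal_ne_top⟩) this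
    rwa [ENNReal.toReal_add (hfin s) ENNReal.ofReal_ne_top,
      ENNReal.toReal_ofReal (by linarith)] at h2
  have wgain : ∀ s t, 0 ≤ s → s ≤ t → Ioc s t ⊆ O → w s + (t - s) ≤ w t := by
    intro s t hs hst hsub
    have : volume (O ∩ Icc 0 s) + ENNReal.ofReal (t - s) ≤ volume (O ∩ Icc 0 t) := by
      rw [← Real.volume_Ioc, ← measure_union _ measurableSet_Ioc]
      · refine measure_mono (union_subset (by gcongr) fun x hx ↦
          ⟨hsub hx, hs.trans hx.1.le, hx.2⟩)
      · rw [disjoint_left]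
        rintro x ⟨-, -, hx⟩ ⟨hx', -⟩
        exact hx.not_gt hx'
    have h2 := ENNReal.toReal_mono (hfin t) this
    rwa [ENNReal.toReal_add (hfin s) ENNReal.ofReal_ne_top,
      ENNReal.toReal_ofReal (by linarith)] at h2
  have wle : w T ≤ ε := by
    refine ENNReal.toReal_le_of_le_ofReal hε.le ((measure_mono inter_subset_left).trans hOvol.le)
  have wcont : Continuous w := by
    have : LipschitzWith 1 w := LipschitzWith.of_dist_le_mul fun s t ↦ by
      rw [Real.dist_eq, Real.dist_eq, NNReal.coe_one, one_mul]
      rcases le_total s t with h | h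
      · rw [abs_sub_comm, abs_sub_comm s, abs_of_nonneg (sub_nonneg.2 (wmono h)),
          abs_of_nonneg (sub_nonneg.2 h)]
        linarith [wlip s t h]
      · rw [abs_of_nonneg (sub_nonneg.2 (wmono h)), abs_of_nonneg (sub_nonneg.2 h)]
        linarith [wlip t s h]
    exact this.continuous
  set h : ℝ → ℝ := fun s ↦ lam * s - v s + ε * s + w s with hh
  have hcont : ContinuousOn h F :=
    (((by fun_prop : Continuous fun s : ℝ ↦ lam * s).continuousOn.sub hv.continuousOn).add
      (by fun_prop)).add wcont.continuousOn
  have progress : ∀ s ∈ F, s < T → ∃ s' ∈ F, s < s' ∧ h s ≤ h s' := by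
    intro s hs hsT
    by_cases hacc : (𝓝[F ∩ Ioi s] s).NeBot
    · by_cases hsO : s ∈ O
      · have hev : ∀ᶠ t in 𝓝[F ∩ Ioi s] s, (t ∈ F ∧ s < t) ∧ Ioc s t ⊆ O := by
          refine (eventually_mem_nhdsWithin).and ?_
          obtain ⟨η, hη, hηO⟩ := Metric.isOpen_iff.1 hO s hsO
          filter_upwards [nhdsWithin_le_nhds (Iio_mem_nhds (show s < s + η by linarith))]
            with t ht x hx
          refine hηO ?_
          rw [mem_ball, Real.dist_eq, abs_lt]
          have := hx.1; have := hx.2; have := mem_Iio.1 ht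
          constructor <;> linarith
        obtain ⟨t, ⟨htF, hst⟩, htO⟩ := hev.exists
        refine ⟨t, htF, hst, ?_⟩
        have h1 := wgain s t (hFT hs).1 hst.le htO
        have h2 : v t - v s ≤ t - s := by
          have := hv.dist_le_mul t htF s hs
          rw [Real.dist_eq, Real.dist_eq, NNReal.coe_one, one_mul, abs_of_pos (sub_pos.2 hst)]
            at this
          exact (le_abs_self _).trans this
        have h3 : 0 ≤ lam * (t - s) := mul_nonneg hlam (sub_nonneg.2 hst.le)
        have h4 : 0 ≤ ε * (t - s) := mul_nonneg hε.le (sub_nonneg.2 hst.le)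
        simp only [hh]
        linarith
      · have hgood : ∀ ε > 0, ∀ᶠ t in 𝓝[F ∩ Ioi s] s, v t - v s ≤ (lam + ε) * (t - s) := by
          by_contra hcon
          exact hsO (hZO fun hcon' ↦ hcon (hcon' hs))
        obtain ⟨t, ⟨htF, hst⟩, ht⟩ := (eventually_mem_nhdsWithin.and (hgood ε hε)).exists
        refine ⟨t, htF, hst, ?_⟩
        have := wmono (le_of_lt hst)
        simp only [hh]
        linarith
    · rw [neBot_iff, not_not, ← empty_mem_iff_bot, mem_nhdsWithin_iff] at hacc
      obtain ⟨η, hη, hηF⟩ := hacc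
      have hclosed : F ∩ Ioi s = F ∩ Ici (s + η) := by
        ext x
        constructor
        · rintro ⟨hx, hsx⟩
          refine ⟨hx, ?_⟩
          by_contra hlt
          refine hηF ⟨?_, hx, hsx⟩
          rw [mem_ball, Real.dist_eq, abs_of_pos (sub_pos.2 hsx)]
          have := not_le.1 (mt mem_Ici.2 hlt)
          linarith
        · rintro ⟨hx, hsx⟩
          exact ⟨hx, show s < x by have := mem_Ici.1 hsx; linarith⟩
      have hcpt : IsCompact (F ∩ Ioi s) := hclosed ▸ hF.inter_right isClosed_Ici
      obtain ⟨t, ⟨htF, hst⟩, htmin⟩ := hcpt.exists_isLeast ⟨T, hT, hsT⟩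
      refine ⟨t, htF, hst, ?_⟩
      have := hgap s hs t htF hst (by
        rw [eq_empty_iff_forall_notMem]
        rintro x ⟨hx, hsx, hxt⟩
        exact hxt.not_ge (htmin ⟨hx, hsx⟩))
      have h3 := wmono (le_of_lt hst)
      have h4 : 0 ≤ ε * (t - s) := mul_nonneg hε.le (sub_nonneg.2 (le_of_lt hst))
      simp only [hh]
      linarith
  have hcpt : IsCompact (F ∩ h ⁻¹' Ici (h 0)) :=
    hF.of_isClosed_subset (hcont.preimage_isClosed_of_isClosed hF.isClosed isClosed_Ici)
      inter_subset_left
  obtain ⟨M, ⟨hMF, hMh⟩, hMmax⟩ := hcpt.exists_isGreatest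
    ⟨0, h0, mem_preimage.2 (mem_Ici.2 le_rfl)⟩
  have hMT : M = T := by
    by_contra hne
    obtain ⟨s, hsF, hMs, hs⟩ := progress M hMF (lt_of_le_of_ne (hFT hMF).2 hne)
    exact (hMmax ⟨hsF, (mem_Ici.1 hMh).trans hs⟩).not_gt hMs
  subst hMT
  have hMh' : h 0 ≤ h M := hMh
  have hw0 : 0 ≤ w 0 := ENNReal.toReal_nonneg
  simp only [hh] at hMh'
  linarith

/-- Points of a compact space are joined, for a metric all of whose shortcuts are realised by
intermediate points, by a compact fragment of a geodesic. -/
lemma sub_le_mul_of_exists_between {N : Type*} [MetricSpace N] [CompactSpace N] {u : N → ℝ}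
    (hu : LipschitzWith 1 u) {lam : ℝ} (hlam : 0 < lam) {r : N → N → ℝ} {C : ℝ}
    (hdr : ∀ x y, dist x y ≤ r x y) (hrC : ∀ x y, r x y ≤ C * dist x y)
    (hrs : ∀ x y, r x y = r y x) (hrt : ∀ x y z, r x z ≤ r x y + r y z)
    (hbet : ∀ x y, lam * r x y < u y - u x → ∃ z, z ≠ x ∧ z ≠ y ∧ r x z + r z y ≤ r x y)
    (hfrag : ∀ (F : Set ℝ) (γ : ℝ → N), IsCompact F → LipschitzOnWith 1 γ F →
      ∀ᵐ t, t ∈ F → ∀ ε > 0, ∀ᶠ s in 𝓝[F ∩ Ioi t] t, u (γ s) - u (γ t) ≤ (lam + ε) * (s - t))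
    (a b : N) : u b - u a ≤ lam * r a b := by
  have hr0 : ∀ x, r x x = 0 := fun x ↦ le_antisymm (by simpa using hrC x x)
    (by simpa using hdr x x)
  have hrn : ∀ x y, 0 ≤ r x y := fun x y ↦ dist_nonneg.trans (hdr x y)
  have hrcont : ∀ x, Continuous (r x) := by
    intro x
    refine LipschitzWith.continuous (K := C.toNNReal) (LipschitzWith.of_le_add_mul _ fun y z ↦ ?_)
    have h1 := hrt x z y
    have h2 := hrC z y
    have h3 : C * dist z y ≤ C.toNNReal * dist z y :=
      mul_le_mul_of_nonneg_right (Real.le_coe_toNNReal C) dist_nonneg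
    rw [dist_comm y z]
    linarith
  set S : Set (Set N) := {Γ | (∀ x ∈ Γ, r a x + r x b = r a b) ∧
    ∀ x ∈ Γ, ∀ y ∈ Γ, |r a x - r a y| = r x y} with hS
  obtain ⟨Γ, habΓ, ⟨hΓ₁, hΓ₂⟩, hmax⟩ := zorn_subset_nonempty S (by
    intro c hcS hc hne
    refine ⟨⋃₀ c, ⟨?_, ?_⟩, fun s hs ↦ subset_sUnion_of_mem hs⟩
    · rintro x ⟨s, hs, hx⟩
      exact (hcS hs).1 x hx
    · rintro x ⟨s, hs, hx⟩ y ⟨t, ht, hy⟩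
      rcases hc.total hs ht with h | h
      · exact (hcS ht).2 x (h hx) y hy
      · exact (hcS hs).2 x hx y (h hy)) {a, b} (by
    refine ⟨?_, ?_⟩
    · rintro x (rfl | rfl) <;> simp [hr0]
    · rintro x (rfl | rfl) y (rfl | rfl) <;> simp [hr0, abs_of_nonneg (hrn _ _)]
      exact hrs _ _)
  have haΓ : a ∈ Γ := habΓ (by simp)
  have hbΓ : b ∈ Γ := habΓ (by simp)
  have hΓclosed : IsClosed Γ := by
    refine isClosed_of_closure_subset (hmax ⟨?_, ?_⟩ subset_closure)
    · intro x hx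
      have : IsClosed {x | r a x + r x b = r a b} := by
        simp_rw [hrs _ b]
        exact isClosed_eq ((hrcont a).add (hrcont b)) continuous_const
      exact closure_minimal (fun x hx ↦ hΓ₁ x hx) this hx
    · have key : ∀ x ∈ Γ, ∀ y ∈ closure Γ, |r a x - r a y| = r x y := fun x hx y hy ↦
        closure_minimal (fun y hy ↦ hΓ₂ x hx y hy) (isClosed_eq
          (continuous_const.sub (hrcont a)).abs (hrcont x)) hy
      intro x hx y hy
      have : IsClosed {x | |r a x - r a y| = r y x} :=
        isClosed_eq ((hrcont a).sub continuous_const).abs (hrcont y)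
      rw [hrs x y]
      exact closure_minimal (fun x hx ↦ (key x hx y hy).trans (hrs x y)) this hx
  have hinj : ∀ x ∈ Γ, ∀ y ∈ Γ, r a x = r a y → x = y := by
    intro x hx y hy h
    have h1 := hΓ₂ x hx y hy
    rw [h, sub_self, abs_zero] at h1
    exact dist_le_zero.1 (h1 ▸ hdr x y)
  have : Nonempty N := ⟨a⟩
  set F : Set ℝ := r a '' Γ with hF
  set γ : ℝ → N := Function.invFunOn (r a) Γ with hγ
  have hγΓ : ∀ s ∈ F, γ s ∈ Γ := fun s hs ↦ Function.invFunOn_mem hs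
  have hγr : ∀ s ∈ F, r a (γ s) = s := fun s hs ↦ Function.invFunOn_eq hs
  have hγx : ∀ x ∈ Γ, γ (r a x) = x := fun x hx ↦
    hinj _ (hγΓ _ ⟨x, hx, rfl⟩) _ hx (hγr _ ⟨x, hx, rfl⟩)
  have hγlip : LipschitzOnWith 1 γ F := by
    refine LipschitzOnWith.of_dist_le_mul fun s hs t ht ↦ ?_
    have := hΓ₂ _ (hγΓ s hs) _ (hγΓ t ht)
    rw [hγr s hs, hγr t ht] at this
    rw [Real.dist_eq, this, NNReal.coe_one, one_mul]
    exact hdr _ _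
  have hFc : IsCompact F := hΓclosed.isCompact.image (hrcont a)
  have hFT : F ⊆ Icc 0 (r a b) := by
    rintro _ ⟨x, hx, rfl⟩
    exact ⟨hrn _ _, by linarith [hΓ₁ x hx, hrn x b]⟩
  have h0F : (0 : ℝ) ∈ F := ⟨a, haΓ, hr0 a⟩
  have hTF : r a b ∈ F := ⟨b, hbΓ, rfl⟩
  have hγ0 : γ 0 = a := by rw [← hr0 a, hγx a haΓ]
  have hγT : γ (r a b) = b := hγx b hbΓ
  have := sub_le_mul_of_ae_slope_le hFc (v := fun s ↦ u (γ s))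
    (by have := hu.comp_lipschitzOnWith hγlip; rwa [one_mul] at this) h0F hTF hFT hlam.le
    (hfrag F γ hFc hγlip) ?_
  · simpa [hγ0, hγT] using this
  rintro _ ⟨x, hx, rfl⟩ _ ⟨y, hy, rfl⟩ hxy hgap
  simp only [hγx x hx, hγx y hy]
  have hrxy : r a y - r a x = r x y := by
    rw [← hΓ₂ x hx y hy, abs_sub_comm, abs_of_pos (sub_pos.2 hxy)]
  rw [hrxy]
  by_contra hlt
  obtain ⟨z, hzx, hzy, hz⟩ := hbet x y (not_le.1 hlt)
  have hz₁ : r a z = r a x + r x z := by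
    linarith [hrt a x z, hrt a z b, hrt z y b, hΓ₁ x hx, hΓ₁ y hy, hrt a z y]
  have hz₂ : r a y = r a z + r z y := by
    linarith [hrt a x z, hrt a z b, hrt z y b, hΓ₁ x hx, hΓ₁ y hy, hrt a z y]
  have hside : ∀ w ∈ Γ, r a w ≤ r a x ∨ r a y ≤ r a w := by
    intro w hw
    by_contra hcon
    push Not at hcon
    have : r a w ∈ F ∩ Ioo (r a x) (r a y) := ⟨⟨w, hw, rfl⟩, hcon⟩
    rw [hgap] at this
    exact this
  have hzw : ∀ w ∈ Γ, |r a z - r a w| = r z w := by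
    intro w hw
    have h1 := hrn x z
    have h2 := hrn z y
    rcases hside w hw with h | h
    · have h3 := hΓ₂ x hx w hw
      rw [abs_of_nonneg (by linarith)] at h3
      rw [abs_of_nonneg (by linarith)]
      linarith [hrt z x w, hrt a w z, hrs z x, hrs w z]
    · have h3 := hΓ₂ y hy w hw
      rw [abs_of_nonpos (by linarith)] at h3
      rw [abs_of_nonpos (by linarith)]
      linarith [hrt z y w, hrt a z w]
  have hzΓ : z ∈ Γ := by
    refine hmax (y := insert z Γ) ⟨?_, ?_⟩ (subset_insert _ _) (mem_insert _ _)
    · rintro w (rfl | hw)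
      · linarith [hrt w y b, hrt a w b, hΓ₁ y hy]
      · exact hΓ₁ w hw
    · rintro w (rfl | hw) w' (rfl | hw')
      · simp [hr0]
      · exact hzw w' hw'
      · rw [abs_sub_comm, hzw w hw, hrs]
      · exact hΓ₂ w hw w' hw'
  rcases hside z hzΓ with h | h
  · refine hzx (hinj z hzΓ x hx ?_)
    linarith [hrn x z]
  · refine hzy (hinj z hzΓ y hy ?_)
    linarith [hrn z y]

end Fragments

section FragmentDistance

/-- The cost of a jump from `x` to `y`: short jumps cost their length, long ones are charged in
addition for the variation of `u`. -/
noncomputable def jumpCost {N : Type*} [MetricSpace N] (u : N → ℝ) (lam : ℝ) (k : ℕ)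
    (x y : N) : ℝ :=
  dist x y + if dist x y ≤ 1 / ((k : ℝ) + 1) then 0 else |u x - u y| / lam

variable {N : Type*} [MetricSpace N] {u : N → ℝ} {lam : ℝ}

lemma dist_le_jumpCost (hlam : 0 < lam) (k : ℕ) (x y : N) : dist x y ≤ jumpCost u lam k x y := by
  unfold jumpCost
  split_ifs
  · simp
  · exact le_add_of_nonneg_right (by positivity)

lemma jumpCost_nonneg (hlam : 0 < lam) (k : ℕ) (x y : N) : 0 ≤ jumpCost u lam k x y :=
  dist_nonneg.trans (dist_le_jumpCost hlam k x y)

lemma jumpCost_comm (k : ℕ) (x y : N) : jumpCost u lam k x y = jumpCost u lam k y x := by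
  simp only [jumpCost, dist_comm x y, abs_sub_comm (u x)]

lemma jumpCost_le (hlam : 0 < lam) (k : ℕ) (x y : N) :
    jumpCost u lam k x y ≤ dist x y + |u x - u y| / lam := by
  unfold jumpCost
  gcongr
  split_ifs
  · positivity
  · exact le_rfl

lemma jumpCost_mono (hlam : 0 < lam) {k l : ℕ} (hkl : k ≤ l) (x y : N) :
    jumpCost u lam k x y ≤ jumpCost u lam l x y := by
  unfold jumpCost
  gcongr
  split_ifs with h h'
  · exact le_rfl
  · positivity
  · exact absurd (‹dist x y ≤ 1 / ((l : ℝ) + 1)›.trans (by gcongr)) h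
  · exact le_rfl

lemma jumpCost_le_mul (hu : LipschitzWith 1 u) (hlam : 0 < lam) (k : ℕ) (x y : N) :
    jumpCost u lam k x y ≤ (1 + 1 / lam) * dist x y := by
  have h := hu.dist_le_mul x y
  rw [Real.dist_eq, NNReal.coe_one, one_mul] at h
  calc jumpCost u lam k x y ≤ dist x y + |u x - u y| / lam := jumpCost_le hlam k x y
    _ ≤ dist x y + dist x y / lam := by gcongr
    _ = _ := by ring

lemma dist_le_chainDist_jumpCost (hlam : 0 < lam) (k : ℕ) (x y : N) :
    dist x y ≤ chainDist (jumpCost u lam k) x y :=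
  le_chainDist (dist_le_jumpCost hlam k) dist_triangle x y

lemma chainDist_jumpCost_le_mul (hu : LipschitzWith 1 u) (hlam : 0 < lam) (k : ℕ) (x y : N) :
    chainDist (jumpCost u lam k) x y ≤ (1 + 1 / lam) * dist x y :=
  (chainDist_le (jumpCost_nonneg hlam k) x y).trans (jumpCost_le_mul hu hlam k x y)

lemma continuous_chainDist_jumpCost (hu : LipschitzWith 1 u) (hlam : 0 < lam) (k : ℕ) :
    Continuous fun p : N × N ↦ chainDist (jumpCost u lam k) p.1 p.2 := by
  have h0 := jumpCost_nonneg (u := u) (N := N) hlam k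
  have hs := jumpCost_comm (u := u) (lam := lam) (N := N) k
  have hlip : ∀ x, LipschitzWith (1 + 1 / lam).toNNReal (chainDist (jumpCost u lam k) x) := by
    refine fun x ↦ LipschitzWith.of_le_add_mul _ fun y z ↦ ?_
    rw [Real.coe_toNNReal _ (by positivity), dist_comm]
    exact (chainDist_triangle h0 x z y).trans
      (add_le_add le_rfl (chainDist_jumpCost_le_mul hu hlam k z y))
  have hlip' : ∀ y, LipschitzWith (1 + 1 / lam).toNNReal
      fun x ↦ chainDist (jumpCost u lam k) x y := by
    intro y
    simp_rw [chainDist_comm h0 hs _ y]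
    exact hlip y
  exact (LipschitzWith.uncurry hlip' hlip).continuous

/-- The limit of the chain distances as the length of free jumps tends to zero. -/
noncomputable def fragDist (u : N → ℝ) (lam : ℝ) (x y : N) : ℝ :=
  ⨆ k, chainDist (jumpCost u lam k) x y

lemma tendsto_fragDist (hu : LipschitzWith 1 u) (hlam : 0 < lam) (x y : N) :
    Tendsto (fun k ↦ chainDist (jumpCost u lam k) x y) atTop (𝓝 (fragDist u lam x y)) :=
  tendsto_atTop_ciSup (fun _ _ hkl ↦ chainDist_mono (jumpCost_nonneg hlam _)
    (jumpCost_mono hlam hkl) x y)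
    ⟨(1 + 1 / lam) * dist x y, by rintro _ ⟨k, rfl⟩; exact chainDist_jumpCost_le_mul hu hlam k x y⟩

lemma chainDist_le_fragDist (hu : LipschitzWith 1 u) (hlam : 0 < lam) (k : ℕ) (x y : N) :
    chainDist (jumpCost u lam k) x y ≤ fragDist u lam x y :=
  le_ciSup (f := fun k ↦ chainDist (jumpCost u lam k) x y)
    ⟨(1 + 1 / lam) * dist x y, by
      rintro _ ⟨k, rfl⟩; exact chainDist_jumpCost_le_mul hu hlam k x y⟩ k

lemma exists_between_of_fragDist_lt [CompactSpace N] (hu : LipschitzWith 1 u) (hlam : 0 < lam)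
    {a b : N} (hab : fragDist u lam a b < dist a b + |u a - u b| / lam) :
    ∃ z, z ≠ a ∧ z ≠ b ∧ fragDist u lam a z + fragDist u lam z b ≤ fragDist u lam a b := by
  set D : ℝ := dist a b + |u a - u b| / lam with hD
  set T := fragDist u lam a b with hT
  have hne : a ≠ b := by
    rintro rfl
    have h1 := (dist_le_chainDist_jumpCost (u := u) hlam 0 a a).trans
      (chainDist_le_fragDist hu hlam 0 a a)
    simp [hD] at hab
    rw [dist_self] at h1
    linarith
  have hdab : 0 < dist a b := dist_pos.2 hne
  have hη : 0 < D - T := sub_pos.2 hab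
  obtain ⟨κ, hκ, hκ1, hκ2⟩ : ∃ κ > 0, (1 + 1 / lam) * (2 * κ) ≤ (D - T) / 2 ∧
      2 * κ ≤ dist a b / 2 := by
    have hC : 0 < 1 + 1 / lam := by positivity
    refine ⟨min ((D - T) / (4 * (1 + 1 / lam))) (dist a b / 4), by positivity, ?_, ?_⟩
    · calc _ ≤ (1 + 1 / lam) * (2 * ((D - T) / (4 * (1 + 1 / lam)))) := by
            gcongr; exact min_le_left _ _
        _ = _ := by field_simp; ring
    · linarith [min_le_right ((D - T) / (4 * (1 + 1 / lam))) (dist a b / 4)]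
  obtain ⟨K, hK⟩ := exists_nat_one_div_lt (show 0 < min ((D - T) / 2) (dist a b / 2) by positivity)
  have hK' : ∀ k, K ≤ k → 1 / ((k : ℝ) + 1) < (D - T) / 2 ∧ 1 / ((k : ℝ) + 1) < dist a b / 2 := by
    intro k hk
    have : 1 / ((k : ℝ) + 1) ≤ 1 / ((K : ℝ) + 1) := by gcongr
    exact lt_min_iff.1 (this.trans_lt hK)
  have key : ∀ k, K ≤ k → ∃ z, κ ≤ dist a z ∧ κ ≤ dist b z ∧
      chainDist (jumpCost u lam k) a z + chainDist (jumpCost u lam k) z b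
        ≤ T + 1 / ((k : ℝ) + 1) := by
    intro k hk
    obtain ⟨l, hl⟩ := exists_lt_of_ciInf_lt (show chainDist (jumpCost u lam k) a b <
      T + 1 / ((k : ℝ) + 1) from (chainDist_le_fragDist hu hlam k a b).trans_lt
        (lt_add_of_pos_right _ (by positivity)))
    rcases exists_intermediate_or_jump (jumpCost_nonneg (u := u) hlam k) hκ (a := a) (b := b) l a
      (by simpa using hκ) with ⟨z, h1, h2, h3⟩ | ⟨x, y, hx, hy, hxy⟩
    · exact ⟨z, h1, h2, h3.trans hl.le⟩
    · exfalso
      have h1 : dist a b ≤ dist x y + 2 * κ := by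
        linarith [dist_triangle4 a x y b, dist_comm y b]
      have h2 : jumpCost u lam k x y = dist x y + |u x - u y| / lam := by
        rw [jumpCost, if_neg]
        linarith [hK' k hk]
      have hx' := hu.dist_le_mul a x
      have hy' := hu.dist_le_mul b y
      rw [Real.dist_eq, NNReal.coe_one, one_mul] at hx' hy'
      have h3 : |u a - u b| ≤ |u x - u y| + 2 * κ := by
        have h4 := abs_sub_le (u a) (u x) (u b)
        have h5 := abs_sub_le (u x) (u y) (u b)
        rw [abs_sub_comm (u y)] at h5
        linarith
      have h4 : |u a - u b| / lam ≤ |u x - u y| / lam + 2 * κ / lam := by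
        rw [← add_div]; gcongr
      have h5 : (1 + 1 / lam) * (2 * κ) = 2 * κ + 2 * κ / lam := by ring
      linarith [hK' k hk]
  have : Nonempty N := ⟨a⟩
  choose! z hz1 hz2 hz3 using key
  obtain ⟨c, -, ψ, hψ, hc⟩ := isCompact_univ.tendsto_subseq (x := fun j ↦ z (K + j))
    (fun _ ↦ mem_univ _)
  have hcz : ∀ w : N, Continuous (dist w) := fun w ↦ by fun_prop
  refine ⟨c, ?_, ?_, ?_⟩
  · rintro rfl
    have := ge_of_tendsto' (((hcz c).tendsto c).comp hc) fun j ↦ hz1 _ (Nat.le_add_right K (ψ j))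
    rw [dist_self] at this
    linarith
  · rintro rfl
    have := ge_of_tendsto' (((hcz c).tendsto c).comp hc) fun j ↦ hz2 _ (Nat.le_add_right K (ψ j))
    rw [dist_self] at this
    linarith
  · have hk : ∀ k, chainDist (jumpCost u lam k) a c + chainDist (jumpCost u lam k) c b ≤ T := by
      intro k
      have hcont := continuous_chainDist_jumpCost (N := N) hu hlam k
      have hl : Tendsto (fun j ↦ chainDist (jumpCost u lam k) a (z (K + ψ j)) +
          chainDist (jumpCost u lam k) (z (K + ψ j)) b) atTop
          (𝓝 (chainDist (jumpCost u lam k) a c + chainDist (jumpCost u lam k) c b)) :=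
        (((hcont.comp (.prodMk_right a)).tendsto c).comp hc).add
          (((hcont.comp (.prodMk_left b)).tendsto c).comp hc)
      have hr : Tendsto (fun j ↦ T + 1 / (((K + ψ j : ℕ) : ℝ) + 1)) atTop (𝓝 (T + 0)) :=
        tendsto_const_nhds.add (tendsto_one_div_add_atTop_nhds_zero_nat.comp
          (tendsto_atTop_mono (fun j ↦ (hψ.id_le j).trans (Nat.le_add_left _ _)) tendsto_id))
      rw [add_zero] at hr
      refine le_of_tendsto_of_tendsto hl hr ?_
      filter_upwards [eventually_ge_atTop k] with j hj
      have hkj : k ≤ K + ψ j := hj.trans ((hψ.id_le j).trans (Nat.le_add_left _ _))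
      have hm := chainDist_mono (jumpCost_nonneg (u := u) hlam k)
        (jumpCost_mono (u := u) (N := N) hlam hkj)
      exact (add_le_add (hm _ _) (hm _ _)).trans (hz3 _ (Nat.le_add_right _ _))
    exact le_of_tendsto' ((tendsto_fragDist hu hlam a c).add (tendsto_fragDist hu hlam c b)) hk

/-- If `u` has slope at most `lam` along all Lipschitz fragments in a compact space, then it is
uniformly close to a function that is `lam`-Lipschitz at small scales. -/
theorem exists_locally_lipschitz_approx [CompactSpace N] (hu : LipschitzWith 1 u)
    (hlam : 0 < lam)
    (hfrag : ∀ (F : Set ℝ) (γ : ℝ → N), IsCompact F → LipschitzOnWith 1 γ F →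
      ∀ᵐ t, t ∈ F → ∀ ε > 0, ∀ᶠ s in 𝓝[F ∩ Ioi t] t, u (γ s) - u (γ t) ≤ (lam + ε) * (s - t))
    {ε : ℝ} (hε : 0 < ε) :
    ∃ (g : N → ℝ) (σ : ℝ), 0 < σ ∧ (∀ x, g x ≤ u x) ∧ (∀ x, u x - ε ≤ g x) ∧
      (∀ x y, |g x - g y| ≤ lam * dist x y + |u x - u y|) ∧
      ∀ x y, dist x y ≤ σ → |g x - g y| ≤ lam * dist x y := by
  have hfd : ∀ a b, u b - u a ≤ lam * fragDist u lam a b := by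
    refine sub_le_mul_of_exists_between hu hlam (C := 1 + 1 / lam) ?_ ?_ ?_ ?_ ?_ hfrag
    · exact fun x y ↦ (dist_le_chainDist_jumpCost hlam 0 x y).trans
        (chainDist_le_fragDist hu hlam 0 x y)
    · exact fun x y ↦ ciSup_le fun k ↦ chainDist_jumpCost_le_mul hu hlam k x y
    · intro x y
      simp only [fragDist, chainDist_comm (jumpCost_nonneg hlam _) (jumpCost_comm _) x y]
    · intro x y z
      exact le_of_tendsto' (tendsto_fragDist hu hlam x z) fun k ↦
        (chainDist_triangle (jumpCost_nonneg hlam k) x y z).trans (add_le_add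
          (chainDist_le_fragDist hu hlam k x y) (chainDist_le_fragDist hu hlam k y z))
    · intro x y hxy
      refine exists_between_of_fragDist_lt hu hlam ?_
      have h1 : fragDist u lam x y < |u x - u y| / lam := by
        rw [lt_div_iff₀ hlam, mul_comm, abs_sub_comm]
        exact hxy.trans_le (le_abs_self _)
      linarith [dist_nonneg (x := x) (y := y)]
  obtain ⟨k, hk⟩ : ∃ k, ∀ a b, u b - u a ≤ lam * chainDist (jumpCost u lam k) a b + ε := by
    set U : ℕ → Set (N × N) := fun k ↦
      {p | u p.2 - u p.1 < lam * chainDist (jumpCost u lam k) p.1 p.2 + ε} with hU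
    have hUo : ∀ k, IsOpen (U k) := fun k ↦
      isOpen_lt ((hu.continuous.comp continuous_snd).sub (hu.continuous.comp continuous_fst))
        (((continuous_chainDist_jumpCost hu hlam k).const_mul lam).add continuous_const)
    have hUc : univ ⊆ ⋃ k, U k := by
      intro p _
      rw [mem_iUnion]
      have := ((tendsto_fragDist hu hlam p.1 p.2).const_mul lam).add_const ε
      exact (this.eventually (lt_mem_nhds (show u p.2 - u p.1 < _ by
        linarith [hfd p.1 p.2]))).exists
    have hUm : Directed (· ⊆ ·) U := by
      refine Monotone.directed_le fun k l hkl p hp ↦ mem_ofPred_eq ▸ lt_of_lt_of_le hp ?_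
      gcongr
      exact chainDist_mono (jumpCost_nonneg hlam k) (jumpCost_mono hlam hkl) _ _
    obtain ⟨k, hk⟩ := isCompact_univ.elim_directed_cover U hUo hUc hUm
    exact ⟨k, fun a b ↦ (hk (mem_univ (a, b))).le⟩
  have h0 := jumpCost_nonneg (u := u) (N := N) hlam k
  have hbdd : ∀ a, BddBelow (range fun b ↦ u b + lam * chainDist (jumpCost u lam k) a b) :=
    fun a ↦ ⟨u a - ε, by
      rintro _ ⟨b, rfl⟩
      have := hk b a
      rw [chainDist_comm h0 (jumpCost_comm k)] at this
      show u a - ε ≤ u b + lam * chainDist (jumpCost u lam k) a b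
      linarith⟩
  set g : N → ℝ := fun a ↦ ⨅ b, u b + lam * chainDist (jumpCost u lam k) a b with hg
  have hg1 : ∀ x y, g x ≤ g y + lam * jumpCost u lam k x y := by
    intro x y
    have : Nonempty N := ⟨x⟩
    rw [← sub_le_iff_le_add]
    refine le_ciInf fun b ↦ ?_
    have h1 := ciInf_le (hbdd x) b
    have h2 := chainDist_le_add h0 x y b
    have h3 := mul_le_mul_of_nonneg_left h2 hlam.le
    simp only [hg]
    linarith
  have hg2 : ∀ x y, |g x - g y| ≤ lam * jumpCost u lam k x y := by
    intro x y
    rw [abs_sub_le_iff]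
    constructor
    · linarith [hg1 x y]
    · rw [jumpCost_comm]; linarith [hg1 y x]
  refine ⟨g, 1 / ((k : ℝ) + 1), by positivity, fun x ↦ ?_, fun x ↦ ?_, fun x y ↦ ?_,
    fun x y hxy ↦ ?_⟩
  · have h1 := ciInf_le (hbdd x) x
    have h2 : chainDist (jumpCost u lam k) x x ≤ 0 := by
      simpa using chainDist_jumpCost_le_mul hu hlam k x x
    have h3 := mul_nonneg hlam.le (sub_nonneg.2 h2)
    simp only [hg]
    linarith
  · have : Nonempty N := ⟨x⟩
    refine le_ciInf fun b ↦ ?_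
    have := hk b x
    rw [chainDist_comm h0 (jumpCost_comm k)] at this
    linarith
  · refine (hg2 x y).trans ((mul_le_mul_of_nonneg_left (jumpCost_le hlam k x y) hlam.le).trans ?_)
    rw [mul_add, mul_div_cancel₀ _ hlam.ne']
  · refine (hg2 x y).trans (le_of_eq ?_)
    rw [jumpCost, if_pos hxy, add_zero]

end FragmentDistance

section Perturbation

variable {X : Type*} [MetricSpace X]

/-- The function `u` has slope at most `lam` along all Lipschitz fragments of curves in `S`. -/
def FragmentSlopeLE (u : X → ℝ) (S : Set X) (lam : ℝ) : Prop :=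
  ∀ (F : Set ℝ) (γ : ℝ → X), IsCompact F → LipschitzOnWith 1 γ F → MapsTo γ F S →
    ∀ᵐ t, t ∈ F → ∀ ε > 0, ∀ᶠ s in 𝓝[F ∩ Ioi t] t, u (γ s) - u (γ t) ≤ (lam + ε) * (s - t)

lemma FragmentSlopeLE.mono {u : X → ℝ} {S T : Set X} {lam : ℝ} (h : FragmentSlopeLE u S lam)
    (hTS : T ⊆ S) : FragmentSlopeLE u T lam :=
  fun F γ hF hγ hm ↦ h F γ hF hγ (hm.mono_right hTS)

/-- A function with slope at most `lam` along fragments in a compact set is uniformly close to a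
function that is `lam`-Lipschitz at small scales on this set and whose increments are not
much larger than those of the original function. -/
theorem FragmentSlopeLE.exists_approx {u : X → ℝ} {S : Set X} {lam : ℝ}
    (h : FragmentSlopeLE u S lam) (hS : IsCompact S) (hu : LipschitzWith 1 u) (hlam : 0 < lam)
    {ε : ℝ} (hε : 0 < ε) :
    ∃ (f : X → ℝ) (σ : ℝ), 0 < σ ∧ (∀ x, |f x - u x| ≤ ε) ∧
      (∀ x y, |f x - f y| ≤ lam * dist x y + |u x - u y|) ∧
      ∀ x ∈ S, ∀ y ∈ S, dist x y ≤ σ → |f x - f y| ≤ lam * dist x y := by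
  rcases S.eq_empty_or_nonempty with rfl | hne
  · refine ⟨u, 1, one_pos, by simp [hε.le], fun x y ↦ ?_, by simp⟩
    have := mul_nonneg hlam.le (dist_nonneg (x := x) (y := y))
    linarith
  have : CompactSpace S := isCompact_iff_compactSpace.1 hS
  have : Nonempty S := hne.to_subtype
  obtain ⟨g, σ, hσ, hgu, hug, hg, hgσ⟩ := exists_locally_lipschitz_approx (N := S)
    (u := fun x ↦ u x) (by have := hu.comp (LipschitzWith.subtype_val S); rwa [one_mul] at this)
    hlam (fun F γ hF hγ ↦ h F (fun t ↦ γ t) hF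
      (by have := (LipschitzWith.subtype_val S).comp_lipschitzOnWith hγ; rwa [one_mul] at this)
      fun t _ ↦ (γ t).2) hε
  set q : X → ℝ := fun x ↦ ⨅ a : S, g a + (lam * dist (a : X) x + |u a - u x|) with hq
  have hlow : ∀ x (a : S), u x - ε ≤ g a + (lam * dist (a : X) x + |u a - u x|) := by
    intro x a
    have h1 := mul_nonneg hlam.le (dist_nonneg (x := (a : X)) (y := x))
    have h2 := neg_abs_le (u a - u x)
    linarith [hug a]
  have hbdd : ∀ x, BddBelow (range fun a : S ↦ g a + (lam * dist (a : X) x + |u a - u x|)) :=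
    fun x ↦ ⟨u x - ε, by rintro _ ⟨a, rfl⟩; exact hlow x a⟩
  have hq1 : ∀ x y, q x ≤ q y + (lam * dist x y + |u x - u y|) := by
    intro x y
    rw [← sub_le_iff_le_add]
    refine le_ciInf fun a ↦ ?_
    have h1 : q x ≤ _ := ciInf_le (hbdd x) a
    have h2 := mul_le_mul_of_nonneg_left (dist_triangle_right (a : X) x y) hlam.le
    have h3 := abs_sub_le (u a) (u y) (u x)
    rw [abs_sub_comm (u y)] at h3
    linarith
  have hqS : ∀ a : S, q a = g a := by
    intro a
    refine le_antisymm ?_ (le_ciInf fun b ↦ ?_)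
    · refine (ciInf_le (hbdd a) a).trans (by simp)
    · have h1 := hg a b
      have h2 := le_abs_self (g a - g b)
      rw [dist_comm, abs_sub_comm (u a)] at h1
      change _ ≤ lam * dist (b : X) a + _ at h1
      linarith
  refine ⟨fun x ↦ min (u x) (q x), σ, hσ, fun x ↦ ?_, fun x y ↦ ?_, fun x hx y hy hxy ↦ ?_⟩
  · have h1 : u x - ε ≤ q x := le_ciInf (hlow x)
    rw [abs_le]
    exact ⟨by linarith [le_min (show u x - ε ≤ u x by linarith) h1],
      by linarith [min_le_left (u x) (q x)]⟩
  · have h0 := mul_nonneg hlam.le (dist_nonneg (x := x) (y := y))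
    refine (abs_min_sub_min_le_max _ _ _ _).trans (max_le (by linarith) ?_)
    rw [abs_sub_le_iff]
    refine ⟨by linarith [hq1 x y], ?_⟩
    have := hq1 y x
    rw [dist_comm, abs_sub_comm] at this
    linarith
  · have hx' := hqS ⟨x, hx⟩
    have hy' := hqS ⟨y, hy⟩
    simp only [hx', hy', min_eq_right (hgu ⟨x, hx⟩), min_eq_right (hgu ⟨y, hy⟩)]
    exact hgσ ⟨x, hx⟩ ⟨y, hy⟩ hxy

variable {E : Type*} [NormedAddCommGroup E] [InnerProductSpace ℝ E]

/-- The map `φ` is `lam`-flat along Lipschitz fragments in `S` in the directions orthogonal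
to `V`. -/
def FragmentFlat (φ : X → E) (S : Set X) (V : Submodule ℝ E) (lam : ℝ) : Prop :=
  ∀ w ∈ Vᗮ, ‖w‖ = 1 → FragmentSlopeLE (fun x ↦ inner ℝ w (φ x)) S lam

lemma FragmentFlat.mono {φ : X → E} {S T : Set X} {V : Submodule ℝ E} {lam : ℝ}
    (h : FragmentFlat φ S V lam) (hTS : T ⊆ S) : FragmentFlat φ T V lam :=
  fun w hw hw1 ↦ (h w hw hw1).mono hTS

lemma exists_abs_le_abs_sub_le {a b c : ℝ} (hc : 0 ≤ c) (h : |a| ≤ c + |b|) :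
    ∃ d, |d| ≤ |b| ∧ |a - d| ≤ c := by
  refine ⟨max (-|b|) (min |b| a), abs_le.2 ⟨le_max_left _ _, max_le (by linarith [abs_nonneg b])
    (min_le_left _ _)⟩, ?_⟩
  have := abs_le.1 h
  have hb := abs_nonneg b
  rw [abs_le]
  constructor <;> rcases max_cases (-|b|) (min |b| a) with h | h <;>
    rcases min_cases |b| a with h' | h' <;> linarith

lemma exists_pos_forall_le {ι : Type*} [Finite ι] {σ : ι → ℝ} (hσ : ∀ i, 0 < σ i) :
    ∃ s > 0, ∀ i, s ≤ σ i := by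
  have h : ∀ᶠ s in 𝓝[>] (0 : ℝ), ∀ i, s ≤ σ i :=
    eventually_all.2 fun i ↦ nhdsWithin_le_nhds (Iic_mem_nhds (hσ i))
  obtain ⟨s, hs, hs'⟩ := (eventually_mem_nhdsWithin.and h).exists
  exact ⟨s, hs, hs'⟩

variable [FiniteDimensional ℝ E]

theorem FragmentFlat.exists_approx {φ : X → E} {S : Set X} {V : Submodule ℝ E} {lam : ℝ}
    (h : FragmentFlat φ S V lam) (hS : IsCompact S) (hφ : LipschitzWith 1 φ) (hlam : 0 < lam)
    {ε : ℝ} (hε : 0 < ε) :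
    ∃ (g : X → E) (σ : ℝ), 0 < σ ∧ (∀ x, ‖g x - φ x‖ ≤ ε) ∧
      (∀ x y, ‖g x - g y‖ ≤ ‖φ x - φ y‖ + Module.finrank ℝ E * (lam * dist x y)) ∧
      ∀ x ∈ S, ∀ y ∈ S, dist x y ≤ σ →
        ‖Vᗮ.starProjection (g x - g y)‖ ≤ Module.finrank ℝ E * (lam * dist x y) := by
  set m := Module.finrank ℝ E with hm
  set b := stdOrthonormalBasis ℝ Vᗮ with hb
  set w : Fin (Module.finrank ℝ Vᗮ) → E := fun i ↦ b i with hw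
  have hwV : ∀ i, w i ∈ Vᗮ := fun i ↦ (b i).2
  have hw1 : ∀ i, ‖w i‖ = 1 := fun i ↦ b.orthonormal.1 i
  have hproj : ∀ e, Vᗮ.starProjection e = ∑ i, inner ℝ (w i) e • w i := by
    intro e
    have := congrArg (Subtype.val) (b.sum_repr' (Vᗮ.orthogonalProjectionOnto e))
    rw [Submodule.starProjection_apply, ← this]
    simp only [Submodule.coe_sum, Submodule.coe_smul, hw]
    refine Finset.sum_congr rfl fun i _ ↦ ?_
    rw [Submodule.inner_orthogonalProjectionOnto_eq_of_mem_left]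
  have hnorm : ∀ c : Fin (Module.finrank ℝ Vᗮ) → ℝ, ‖∑ i, c i • w i‖ ^ 2 = ∑ i, c i ^ 2 := by
    intro c
    have h1 : ∑ i, c i • w i = ((b.repr.symm (WithLp.toLp 2 c) : Vᗮ) : E) := by
      rw [← b.sum_repr_symm]
      simp [hw]
    rw [h1, ← Submodule.coe_norm, LinearIsometryEquiv.norm_map, EuclideanSpace.norm_sq_eq]
    simp
  have hcard : ∀ {c : Fin (Module.finrank ℝ Vᗮ) → ℝ} {B : ℝ}, 0 ≤ B → (∀ i, |c i| ≤ B) →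
      ‖∑ i, c i • w i‖ ≤ m * B := by
    intro c B hB hc
    calc ‖∑ i, c i • w i‖ ≤ ∑ i, ‖c i • w i‖ := norm_sum_le _ _
      _ ≤ ∑ i : Fin (Module.finrank ℝ Vᗮ), B := by
          gcongr with i; rw [norm_smul, hw1, mul_one]; exact hc i
      _ = Module.finrank ℝ Vᗮ * B := by simp
      _ ≤ m * B := by gcongr; exact Submodule.finrank_le _
  have hu : ∀ i, LipschitzWith 1 fun x ↦ inner ℝ (w i) (φ x) := by
    intro i
    refine LipschitzWith.of_dist_le_mul fun x y ↦ ?_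
    rw [Real.dist_eq, ← inner_sub_right]
    refine (abs_real_inner_le_norm _ _).trans ?_
    rw [hw1, one_mul, ← dist_eq_norm]
    exact hφ.dist_le_mul x y
  choose f σ hσ hfu hf hfS using fun i ↦ (h (w i) (hwV i) (hw1 i)).exists_approx hS (hu i) hlam
    (show 0 < ε / (m + 1) by positivity)
  set g : X → E := fun x ↦ V.starProjection (φ x) + ∑ i, f i x • w i with hg
  have hφdec : ∀ e, V.starProjection e + ∑ i, inner ℝ (w i) e • w i = e := fun e ↦ by
    rw [← hproj, Submodule.starProjection_add_starProjection_orthogonal]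
  have hgd : ∀ x y, g x - g y = V.starProjection (φ x - φ y) + ∑ i, (f i x - f i y) • w i := by
    intro x y
    simp only [hg, map_sub, sub_smul, Finset.sum_sub_distrib]
    abel
  have hVV : ∀ c : Fin (Module.finrank ℝ Vᗮ) → ℝ, ∑ i, c i • w i ∈ Vᗮ :=
    fun c ↦ Submodule.sum_mem _ fun i _ ↦ Submodule.smul_mem _ _ (hwV i)
  obtain ⟨σ₀, hσ₀, hσ₀'⟩ := exists_pos_forall_le hσ
  refine ⟨g, σ₀, hσ₀, fun x ↦ ?_, fun x y ↦ ?_, fun x hx y hy hxy ↦ ?_⟩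
  · have : g x - φ x = ∑ i, (f i x - inner ℝ (w i) (φ x)) • w i := by
      simp only [hg, sub_smul, Finset.sum_sub_distrib]
      rw [sub_eq_iff_eq_add, ← sub_eq_iff_eq_add', sub_sub_eq_add_sub]
      nth_rewrite 3 [← hφdec (φ x)]
      abel
    rw [this]
    refine (hcard (by positivity) fun i ↦ hfu i x).trans ?_
    rw [mul_div_assoc', div_le_iff₀ (by positivity)]
    nlinarith
  · choose d hd hd' using fun i ↦ exists_abs_le_abs_sub_le
      (mul_nonneg hlam.le (dist_nonneg (x := x) (y := y))) (hf i x y)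
    have : g x - g y = (V.starProjection (φ x - φ y) + ∑ i, d i • w i) +
        ∑ i, (f i x - f i y - d i) • w i := by
      rw [hgd]
      simp only [sub_smul, Finset.sum_sub_distrib]
      abel
    rw [this]
    refine (norm_add_le _ _).trans (add_le_add ?_ (hcard (by positivity) hd'))
    refine le_of_sq_le_sq ?_ (norm_nonneg _)
    have hin : ∀ c : Fin (Module.finrank ℝ Vᗮ) → ℝ,
        ‖V.starProjection (φ x - φ y) + ∑ i, c i • w i‖ ^ 2 =
          ‖V.starProjection (φ x - φ y)‖ ^ 2 + ∑ i, c i ^ 2 := by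
      intro c
      rw [← hnorm, sq, sq, sq]
      exact norm_add_sq_eq_norm_sq_add_norm_sq_of_inner_eq_zero _ _
        (hVV c _ (Submodule.starProjection_apply_mem _ _))
    conv_rhs => rw [← hφdec (φ x - φ y)]
    rw [hin, hin]
    refine add_le_add_right (Finset.sum_le_sum fun i _ ↦ sq_le_sq.2 ?_) _
    rw [inner_sub_right]
    exact hd i
  · have h0 : Vᗮ.starProjection (V.starProjection (φ x - φ y)) = 0 :=
      (Submodule.starProjection_apply_eq_zero_iff _).2
        (Submodule.le_orthogonal_orthogonal V (Submodule.starProjection_apply_mem _ _))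
    rw [hgd, map_add, Submodule.starProjection_eq_self_iff.2 (hVV _), h0, zero_add]
    exact hcard (by positivity) fun i ↦ hfS i x hx y hy (hxy.trans (hσ₀' i))

/-- Disjointly located flat pieces can be flattened simultaneously by a small perturbation. -/
theorem exists_approx_of_fragmentFlat {ι : Type*} [Finite ι] {φ : X → E} {S : ι → Set X}
    {V : ι → Submodule ℝ E} {lam K : ℝ} (hflat : ∀ i, FragmentFlat φ (S i) (V i) lam)
    (hS : ∀ i, IsCompact (S i)) (hdisj : Pairwise (Function.onFun Disjoint S))
    (hφ : ∀ x y, ‖φ x - φ y‖ ≤ K * dist x y) (hlam : 0 < lam)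
    (hK : K + Module.finrank ℝ E * lam < 1) {ε : ℝ} (hε : 0 < ε) :
    ∃ (g : X → E) (σ : ℝ), 0 < σ ∧ LipschitzWith 1 g ∧ (∀ x, ‖g x - φ x‖ ≤ ε) ∧
      ∀ i, ∀ x ∈ S i, ∀ y ∈ S i, dist x y ≤ σ →
        ‖(V i)ᗮ.starProjection (g x - g y)‖ ≤ Module.finrank ℝ E * (lam * dist x y) := by
  classical
  have := Fintype.ofFinite ι
  set m := Module.finrank ℝ E with hm
  have hφ1 : LipschitzWith 1 φ := LipschitzWith.of_dist_le_mul fun x y ↦ by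
    rw [dist_eq_norm, NNReal.coe_one]
    refine (hφ x y).trans (mul_le_mul_of_nonneg_right ?_ dist_nonneg)
    have : 0 ≤ (m : ℝ) * lam := by positivity
    linarith
  have hδp : ∀ p : ι × ι, ∃ δ > 0, p.1 ≠ p.2 →
      Disjoint (thickening δ (S p.1)) (thickening δ (S p.2)) := by
    intro p
    by_cases hp : p.1 = p.2
    · exact ⟨1, one_pos, fun h ↦ absurd hp h⟩
    · obtain ⟨δ, hδ, h⟩ := (hdisj hp).exists_thickenings (hS _) (hS _).isClosed
      exact ⟨δ, hδ, fun _ ↦ h⟩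
  choose δp hδp hδpd using hδp
  obtain ⟨δ, hδ, hδle⟩ := exists_pos_forall_le hδp
  have hδd : ∀ i j, i ≠ j → Disjoint (thickening δ (S i)) (thickening δ (S j)) := fun i j hij ↦
    (hδpd (i, j) hij).mono (thickening_mono (hδle (i, j)) _) (thickening_mono (hδle (i, j)) _)
  set χ : ι → X → ℝ := fun i x ↦ thickenedIndicator hδ (S i) x with hχ
  have hχ0 : ∀ i x, 0 ≤ χ i x := fun i x ↦ NNReal.coe_nonneg _
  have hχ1 : ∀ i x, x ∈ S i → χ i x = 1 := fun i x hx ↦ by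
    simp only [hχ, thickenedIndicator_one hδ (S i) hx, NNReal.coe_one]
  have hχout : ∀ i x, x ∉ thickening δ (S i) → χ i x = 0 := fun i x hx ↦ by
    simp only [hχ, thickenedIndicator_zero hδ (S i) hx, NNReal.coe_zero]
  have hχlip : ∀ i x y, |χ i x - χ i y| ≤ δ⁻¹ * dist x y := by
    intro i x y
    have := (lipschitzWith_thickenedIndicator hδ (S i)).dist_le_mul x y
    rwa [NNReal.dist_eq, NNReal.coe_inv, Real.coe_toNNReal _ hδ.le] at this
  have hχone : ∀ i x, x ∈ thickening δ (S i) → ∀ j, j ≠ i → χ j x = 0 := fun i x hx j hji ↦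
    hχout j x fun hx' ↦ disjoint_left.1 (hδd j i hji) hx' hx
  have hχsum : ∀ x, ∑ i, χ i x ≤ 1 := by
    intro x
    by_cases hx : ∃ i, x ∈ thickening δ (S i)
    · obtain ⟨i, hi⟩ := hx
      rw [Finset.sum_eq_single i (fun j _ hji ↦ hχone i x hi j hji) (by simp)]
      exact_mod_cast thickenedIndicator_le_one hδ (S i) x
    · push Not at hx
      rw [Finset.sum_eq_zero fun i _ ↦ hχout i x (hx i)]
      exact zero_le_one
  set η : ℝ := min ε ((1 - K - m * lam) * δ / (Fintype.card ι + 1)) with hη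
  have hηpos : 0 < η := lt_min hε (by
    have : 0 < 1 - K - m * lam := by linarith
    positivity)
  have hηle : Fintype.card ι * (δ⁻¹ * η) ≤ 1 - K - m * lam := by
    have h1 : (Fintype.card ι + 1) * η ≤ (1 - K - m * lam) * δ := by
      rw [← le_div_iff₀' (by positivity)]; exact min_le_right _ _
    have h2 : Fintype.card ι * (δ⁻¹ * η) = (Fintype.card ι * η) / δ := by ring
    rw [h2, div_le_iff₀ hδ]
    linarith
  choose f σ hσ hfφ hf hfS using fun i ↦ (hflat i).exists_approx (hS i) hφ1 hlam hηpos
  obtain ⟨s, hs, hsσ⟩ := exists_pos_forall_le hσ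
  set g : X → E := fun x ↦ φ x + ∑ i, χ i x • (f i x - φ x) with hg
  have hgS : ∀ i, ∀ x ∈ S i, g x = f i x := by
    intro i x hx
    simp only [hg]
    rw [Finset.sum_eq_single i (fun j _ hji ↦ by
      rw [hχone i x (self_subset_thickening hδ _ hx) j hji, zero_smul]) (by simp),
      hχ1 i x hx, one_smul, add_sub_cancel]
  refine ⟨g, s, hs, LipschitzWith.of_dist_le_mul fun x y ↦ ?_, fun x ↦ ?_, fun i x hx y hy hxy ↦ ?_⟩
  · rw [dist_eq_norm, NNReal.coe_one, one_mul]
    have hdec : g x - g y = (1 - ∑ i, χ i x) • (φ x - φ y) + ∑ i, χ i x • (f i x - f i y)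
        + ∑ i, (χ i x - χ i y) • (f i y - φ y) := by
      simp only [hg, sub_smul, one_smul, smul_sub, Finset.sum_sub_distrib, Finset.sum_smul]
      abel
    have hd := dist_nonneg (x := x) (y := y)
    set B : ℝ := ‖φ x - φ y‖ + m * (lam * dist x y) with hB
    have hBn : ‖φ x - φ y‖ ≤ B := le_add_of_nonneg_right (by positivity)
    have h1 : ‖(1 - ∑ i, χ i x) • (φ x - φ y)‖ ≤ (1 - ∑ i, χ i x) * B := by
      rw [norm_smul, Real.norm_of_nonneg (sub_nonneg.2 (hχsum x))]
      exact mul_le_mul_of_nonneg_left hBn (sub_nonneg.2 (hχsum x))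
    have h2 : ‖∑ i, χ i x • (f i x - f i y)‖ ≤ (∑ i, χ i x) * B := by
      rw [Finset.sum_mul]
      refine (norm_sum_le _ _).trans (Finset.sum_le_sum fun i _ ↦ ?_)
      rw [norm_smul, Real.norm_of_nonneg (hχ0 i x)]
      exact mul_le_mul_of_nonneg_left (hf i x y) (hχ0 i x)
    have h3 : ‖∑ i, (χ i x - χ i y) • (f i y - φ y)‖ ≤
        Fintype.card ι * (δ⁻¹ * η) * dist x y := by
      calc _ ≤ ∑ i : ι, δ⁻¹ * dist x y * η := by
            refine (norm_sum_le _ _).trans (Finset.sum_le_sum fun i _ ↦ ?_)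
            rw [norm_smul, Real.norm_eq_abs]
            exact mul_le_mul (hχlip i x y) (hfφ i y) (norm_nonneg _) (by positivity)
        _ = _ := by simp only [Finset.sum_const, Finset.card_univ, nsmul_eq_mul]; ring
    have h4 := mul_le_mul_of_nonneg_right hηle hd
    calc ‖g x - g y‖ ≤ (1 - ∑ i, χ i x) * B + (∑ i, χ i x) * B +
          Fintype.card ι * (δ⁻¹ * η) * dist x y := by
          rw [hdec]
          exact (norm_add₃_le).trans (by gcongr)
      _ ≤ B + (1 - K - m * lam) * dist x y := by linarith
      _ ≤ dist x y := by rw [hB]; linarith [hφ x y]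
  · simp only [hg, add_sub_cancel_left]
    calc ‖∑ i, χ i x • (f i x - φ x)‖ ≤ ∑ i, χ i x * η := by
          refine (norm_sum_le _ _).trans (Finset.sum_le_sum fun i _ ↦ ?_)
          rw [norm_smul, Real.norm_of_nonneg (hχ0 i x)]
          exact mul_le_mul_of_nonneg_left (hfφ i x) (hχ0 i x)
      _ = (∑ i, χ i x) * η := (Finset.sum_mul ..).symm
      _ ≤ 1 * η := mul_le_mul_of_nonneg_right (hχsum x) hηpos.le
      _ ≤ ε := by rw [one_mul]; exact min_le_left _ _
  · rw [hgS i x hx, hgS i y hy]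
    exact hfS i x hx y hy (hxy.trans (hsσ i))

end Perturbation

section Content

/-- The `n`-dimensional Hausdorff content of a set. -/
noncomputable def hausdorffContent (n : ℕ) (X : Type*) [PseudoEMetricSpace X] : OuterMeasure X :=
  OuterMeasure.boundedBy fun s ↦ ediam s ^ n

lemma hausdorffContent_le_ediam_pow {X : Type*} [PseudoEMetricSpace X] (n : ℕ) (s : Set X) :
    hausdorffContent n X s ≤ ediam s ^ n :=
  OuterMeasure.boundedBy_le s

lemma hausdorffContent_le_hausdorffMeasure {X : Type*} [EMetricSpace X] [MeasurableSpace X]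
    [BorelSpace X] (n : ℕ) (s : Set X) : hausdorffContent n X s ≤ μH[n] s := by
  rw [hausdorffContent, OuterMeasure.boundedBy_apply, Measure.hausdorffMeasure_apply]
  refine le_iSup₂_of_le ∞ ENNReal.zero_lt_top (le_iInf₂ fun t ht ↦ le_iInf fun _ ↦ ?_)
  refine iInf₂_le_of_le t ht (le_of_eq ?_)
  simp_rw [ENNReal.rpow_natCast]

lemma hausdorffMeasure_eq_zero_of_hausdorffContent {X : Type*} [EMetricSpace X]
    [MeasurableSpace X] [BorelSpace X] {n : ℕ} (hn : n ≠ 0) {s : Set X}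
    (h : hausdorffContent n X s = 0) : μH[n] s = 0 := by
  rw [← nonpos_iff_eq_zero, Measure.hausdorffMeasure_apply]
  refine iSup₂_le fun r hr ↦ le_of_forall_gt fun ε hε ↦ ?_
  have hpos : 0 < min ε (r ^ n) := lt_min hε (ENNReal.pow_pos hr n)
  rw [hausdorffContent, OuterMeasure.boundedBy_apply] at h
  obtain ⟨t, ht⟩ := iInf_lt_iff.1 (h.trans_lt hpos)
  obtain ⟨hst, hsum⟩ := iInf_lt_iff.1 ht
  have hr' : ∀ k, ediam (t k) ≤ r := by
    intro k
    rcases (t k).eq_empty_or_nonempty with h0 | h0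
    · simp [h0]
    · rw [← ENNReal.pow_le_pow_left_iff hn]
      calc ediam (t k) ^ n ≤ ⨆ _ : (t k).Nonempty, ediam (t k) ^ n := le_iSup_of_le h0 le_rfl
        _ ≤ _ := ENNReal.le_tsum k
        _ ≤ r ^ n := hsum.le.trans (min_le_right _ _)
  refine (iInf₂_le_of_le t hst (iInf_le_of_le hr' le_rfl)).trans_lt ?_
  simp_rw [ENNReal.rpow_natCast]
  exact hsum.trans_le (min_le_left _ _)

lemma exists_isOpen_hausdorffContent_lt {X : Type*} [PseudoEMetricSpace X] {n : ℕ}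
    {s : Set X} {δ : ℝ≥0∞} (h : hausdorffContent n X s < δ) :
    ∃ U, IsOpen U ∧ s ⊆ U ∧ hausdorffContent n X U < δ := by
  rw [hausdorffContent, OuterMeasure.boundedBy_apply] at h
  obtain ⟨t, ht⟩ := iInf_lt_iff.1 h
  obtain ⟨hst, hsum⟩ := iInf_lt_iff.1 ht
  obtain ⟨ε, hε, hεsum⟩ := ENNReal.exists_pos_sum_of_countable' (tsub_pos_of_lt hsum).ne' ℕ
  have key : ∀ k, ∃ r : ℝ, 0 < r ∧ hausdorffContent n X (thickening r (t k)) ≤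
      (⨆ _ : (t k).Nonempty, ediam (t k) ^ n) + ε k := by
    intro k
    rcases (t k).eq_empty_or_nonempty with h0 | h0
    · exact ⟨1, one_pos, by simp [h0]⟩
    have hfin : ediam (t k) ^ n ≠ ∞ := by
      refine ne_of_lt ?_
      calc ediam (t k) ^ n ≤ ⨆ _ : (t k).Nonempty, ediam (t k) ^ n := le_iSup_of_le h0 le_rfl
        _ ≤ _ := ENNReal.le_tsum k
        _ < ∞ := hsum.trans_le le_top
    have hlim : Tendsto (fun r : ℝ≥0 ↦ (ediam (t k) + 2 * (r : ℝ≥0∞)) ^ n) (𝓝[>] 0)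
        (𝓝 (ediam (t k) ^ n)) := by
      have : Continuous fun r : ℝ≥0 ↦ (ediam (t k) + 2 * (r : ℝ≥0∞)) ^ n := by
        fun_prop (disch := finiteness)
      have h2 := (this.tendsto 0).mono_left (nhdsWithin_le_nhds (s := Ioi 0))
      simpa using h2
    have hlt : ediam (t k) ^ n < ediam (t k) ^ n + ε k := ENNReal.lt_add_right hfin (hε k).ne'
    obtain ⟨r, hr0, hr⟩ := (eventually_mem_nhdsWithin.and
      (hlim.eventually (gt_mem_nhds hlt))).exists
    refine ⟨r, hr0, (hausdorffContent_le_ediam_pow n _).trans ?_⟩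
    rw [ciSup_pos h0]
    exact (pow_le_pow_left' (ediam_thickening_le r) n).trans hr.le
  choose r hr0 hr using key
  refine ⟨⋃ k, thickening (r k) (t k), isOpen_iUnion fun k ↦ isOpen_thickening,
    hst.trans (iUnion_mono fun k ↦ self_subset_thickening (hr0 k) _), ?_⟩
  calc _ ≤ ∑' k, hausdorffContent n X (thickening (r k) (t k)) := measure_iUnion_le _
    _ ≤ ∑' k, ((⨆ _ : (t k).Nonempty, ediam (t k) ^ n) + ε k) := ENNReal.tsum_le_tsum hr
    _ = (∑' k, ⨆ _ : (t k).Nonempty, ediam (t k) ^ n) + ∑' k, ε k := ENNReal.tsum_add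
    _ < δ := by
      rw [add_comm]
      exact lt_tsub_iff_right.1 hεsum

variable {E : Type*} [NormedAddCommGroup E] [InnerProductSpace ℝ E] [FiniteDimensional ℝ E]

/-- A set of diameter `s` that is nearly contained in a translate of a subspace of dimension
less than `n` has small content. -/
lemma hausdorffContent_le_of_flat {n : ℕ} {V : Submodule ℝ E} (hV : Module.finrank ℝ V < n)
    {lam : ℝ} (hlam : 0 < lam) (hlam1 : lam ≤ 1) {T : Set E} {s : ℝ} (hs : 0 < s)
    (hT : ∀ x ∈ T, ∀ y ∈ T, ‖x - y‖ ≤ s)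
    (hflat : ∀ x ∈ T, ∀ y ∈ T,
      ‖Vᗮ.starProjection (x - y)‖ ≤ Module.finrank ℝ E * (lam * s)) :
    hausdorffContent n E T ≤
      ENNReal.ofReal (3 ^ n * (3 * Module.finrank ℝ E) ^ n * lam * s ^ n) := by
  set m := Module.finrank ℝ E with hm
  set q := Module.finrank ℝ V with hq
  have hqm : q ≤ m := Submodule.finrank_le _
  rcases T.eq_empty_or_nonempty with rfl | ⟨x₀, hx₀⟩
  · simp
  set b := stdOrthonormalBasis ℝ V with hb
  have hb1 : ∀ i, ‖((b i : V) : E)‖ = 1 := fun i ↦ b.orthonormal.1 i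
  have hproj : ∀ e, V.starProjection e = ∑ i, inner ℝ ((b i : V) : E) e • ((b i : V) : E) := by
    intro e
    have := congrArg (Subtype.val) (b.sum_repr' (V.orthogonalProjectionOnto e))
    rw [Submodule.starProjection_apply, ← this]
    simp only [Submodule.coe_sum, Submodule.coe_smul]
    refine Finset.sum_congr rfl fun i _ ↦ ?_
    rw [Submodule.inner_orthogonalProjectionOnto_eq_of_mem_left]
  set M : ℕ := ⌈1 / lam⌉₊ with hM
  have hM1 : 1 / lam ≤ M := Nat.le_ceil _
  have hM2 : (M : ℝ) + 1 ≤ 3 / lam := by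
    have h1 := Nat.ceil_lt_add_one (show 0 ≤ 1 / lam by positivity)
    have h2 : 1 ≤ 1 / lam := by rw [le_div_iff₀ hlam]; linarith
    have h3 : 3 / lam = 1 / lam + 1 / lam + 1 / lam := by ring
    rw [h3]
    linarith
  have hMpos : (0 : ℝ) < M := lt_of_lt_of_le (by positivity) hM1
  set c : Fin q → E → ℝ := fun i x ↦ (inner ℝ ((b i : V) : E) (x - x₀) + s) * (M / (2 * s)) with hc
  have hcT : ∀ i, ∀ x ∈ T, 0 ≤ c i x ∧ c i x ≤ M := by
    intro i x hx
    have h1 : |inner ℝ ((b i : V) : E) (x - x₀)| ≤ s := by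
      have := abs_real_inner_le_norm ((b i : V) : E) (x - x₀)
      rw [hb1, one_mul] at this
      exact this.trans (hT x hx x₀ hx₀)
    rw [abs_le] at h1
    have h2 : (0 : ℝ) ≤ M / (2 * s) := by positivity
    refine ⟨mul_nonneg (by linarith) h2, ?_⟩
    calc c i x ≤ (s + s) * (M / (2 * s)) := mul_le_mul_of_nonneg_right (by linarith) h2
      _ = M := by field_simp; ring
  set P : (Fin q → Fin (M + 1)) → Set E := fun j ↦ {x ∈ T | ∀ i, ⌊c i x⌋₊ = j i} with hP
  have hTP : T ⊆ ⋃ j, P j := by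
    intro x hx
    refine mem_iUnion.2 ⟨fun i ↦ ⟨⌊c i x⌋₊, ?_⟩, hx, fun i ↦ rfl⟩
    exact Nat.lt_succ_of_le (Nat.floor_le_of_le (hcT i x hx).2)
  have hdiam : ∀ j, ediam (P j) ≤ ENNReal.ofReal (3 * m * (lam * s)) := by
    intro j
    refine ediam_le fun x hx y hy ↦ ?_
    rw [edist_dist]
    refine ENNReal.ofReal_le_ofReal ?_
    rw [dist_eq_norm, ← V.starProjection_add_starProjection_orthogonal (x - y)]
    have h1 : ∀ i, |inner ℝ ((b i : V) : E) (x - y)| ≤ 2 * (lam * s) := by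
      intro i
      have h2 : |c i x - c i y| ≤ 1 := by
        have hx1 := Nat.floor_le (hcT i x hx.1).1
        have hy1 := Nat.floor_le (hcT i y hy.1).1
        have hx2 := Nat.lt_floor_add_one (c i x)
        have hy2 := Nat.lt_floor_add_one (c i y)
        rw [hx.2 i] at hx1 hx2
        rw [hy.2 i] at hy1 hy2
        rw [abs_le]
        constructor <;> linarith
      have h3 : inner ℝ ((b i : V) : E) (x - y) = (c i x - c i y) * (2 * s / M) := by
        have : x - y = (x - x₀) - (y - x₀) := by abel
        simp only [hc]
        rw [this, inner_sub_right]
        field_simp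
        ring
      rw [h3, abs_mul, abs_of_pos (show 0 < 2 * s / M by positivity)]
      calc _ ≤ 1 * (2 * s / M) := by gcongr
        _ = (2 * s) * (1 / M) := by ring
        _ ≤ (2 * s) * lam := by
            gcongr
            rw [div_le_iff₀ hMpos]
            rw [div_le_iff₀ hlam] at hM1
            linarith
        _ = _ := by ring
    have h2 : ‖V.starProjection (x - y)‖ ≤ m * (2 * (lam * s)) := by
      rw [hproj]
      calc _ ≤ ∑ i : Fin q, 2 * (lam * s) := by
            refine (norm_sum_le _ _).trans (Finset.sum_le_sum fun i _ ↦ ?_)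
            rw [norm_smul, hb1, mul_one]
            exact h1 i
        _ = q * (2 * (lam * s)) := by simp
        _ ≤ _ := by gcongr
    calc _ ≤ m * (2 * (lam * s)) + m * (lam * s) :=
          (norm_add_le _ _).trans (add_le_add h2 (hflat x hx.1 y hy.1))
      _ = _ := by ring
  obtain ⟨k, rfl⟩ : ∃ k, n = k + 1 := ⟨n - 1, by omega⟩
  calc hausdorffContent (k + 1) E T ≤ hausdorffContent (k + 1) E (⋃ j, P j) := measure_mono hTP
    _ ≤ ∑ j, hausdorffContent (k + 1) E (P j) := measure_iUnion_fintype_le _ _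
    _ ≤ ∑ j : Fin q → Fin (M + 1), ENNReal.ofReal (3 * m * (lam * s)) ^ (k + 1) := by
        gcongr with j
        exact (hausdorffContent_le_ediam_pow _ _).trans (pow_le_pow_left' (hdiam j) _)
    _ = ENNReal.ofReal (((M : ℝ) + 1) ^ q * (3 * m * (lam * s)) ^ (k + 1)) := by
        rw [ENNReal.ofReal_mul (p := ((M : ℝ) + 1) ^ q) (by positivity),
          ENNReal.ofReal_pow (by positivity),
          ENNReal.ofReal_pow (p := 3 * m * (lam * s)) (by positivity)]
        have : ENNReal.ofReal ((M : ℝ) + 1) = ((M + 1 : ℕ) : ℝ≥0∞) := by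
          rw [← ENNReal.ofReal_natCast]; push_cast; rfl
        rw [this]
        simp
    _ ≤ _ := by
        refine ENNReal.ofReal_le_ofReal ?_
        calc ((M : ℝ) + 1) ^ q * (3 * m * (lam * s)) ^ (k + 1)
            ≤ (3 / lam) ^ k * (3 * m * (lam * s)) ^ (k + 1) := by
              gcongr
              refine (pow_le_pow_right₀ (by linarith) (Nat.le_of_lt_succ hV)).trans ?_
              gcongr
          _ = 3 ^ k * (3 * m) ^ (k + 1) * lam * s ^ (k + 1) := by
              rw [div_pow, mul_pow (3 * (m : ℝ)), mul_pow lam, pow_succ lam]; field_simp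
          _ ≤ _ := by
              gcongr
              · norm_num
              · omega

/-- The content of the image of a set under a `1`-Lipschitz map that is nearly flat at small
scales is small compared with the measure of the set. -/
lemma hausdorffContent_image_le_of_flat {X : Type*} [MetricSpace X] [MeasurableSpace X]
    [BorelSpace X] {n : ℕ} {V : Submodule ℝ E} (hV : Module.finrank ℝ V < n)
    {lam : ℝ} (hlam : 0 < lam) (hlam1 : lam ≤ 1) {g : X → E} (hg : LipschitzWith 1 g) {S : Set X}
    {σ : ℝ} (hσ : 0 < σ)
    (hflat : ∀ x ∈ S, ∀ y ∈ S, dist x y ≤ σ →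
      ‖Vᗮ.starProjection (g x - g y)‖ ≤ Module.finrank ℝ E * (lam * dist x y)) :
    hausdorffContent n E (g '' S) ≤
      ENNReal.ofReal (3 ^ n * (3 * (Module.finrank ℝ E + 1)) ^ n * lam) * μH[n] S := by
  set C : ℝ := 3 ^ n * (3 * (Module.finrank ℝ E + 1)) ^ n * lam with hC
  have hC0 : 0 < C := by positivity
  have key : ∀ t : Set X, ediam t ≤ ENNReal.ofReal σ →
      hausdorffContent n E (g '' (S ∩ t)) ≤ ENNReal.ofReal C * ediam t ^ n := by
    intro t ht
    have htfin : ediam t ≠ ∞ := (ht.trans_lt ENNReal.ofReal_lt_top).ne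
    have hle : ediam (g '' (S ∩ t)) ≤ ediam t := by
      have := hg.ediam_image_le (S ∩ t)
      rw [ENNReal.coe_one, one_mul] at this
      exact this.trans (ediam_mono inter_subset_right)
    rcases eq_or_ne (ediam t) 0 with h0 | h0
    · refine (hausdorffContent_le_ediam_pow _ _).trans ?_
      rw [nonpos_iff_eq_zero.1 (hle.trans h0.le), zero_pow (by omega)]
      exact zero_le
    set s := (ediam t).toReal with hs
    have hs0 : 0 < s := ENNReal.toReal_pos h0 htfin
    have hst : ∀ x ∈ t, ∀ y ∈ t, dist x y ≤ s := fun x hx y hy ↦ by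
      rw [dist_edist]
      exact ENNReal.toReal_mono htfin (edist_le_ediam_of_mem hx hy)
    have hsσ : s ≤ σ := ENNReal.toReal_le_of_le_ofReal hσ.le ht
    have := hausdorffContent_le_of_flat hV hlam hlam1 hs0 (T := g '' (S ∩ t)) ?_ ?_
    · refine this.trans ?_
      rw [← ENNReal.ofReal_toReal htfin, ← hs, ← ENNReal.ofReal_pow hs0.le,
        ← ENNReal.ofReal_mul hC0.le]
      refine ENNReal.ofReal_le_ofReal ?_
      rw [hC]
      gcongr
      simp
    · rintro _ ⟨x, hx, rfl⟩ _ ⟨y, hy, rfl⟩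
      have := hg.dist_le_mul x y
      rw [dist_eq_norm, NNReal.coe_one, one_mul] at this
      exact this.trans (hst x hx.2 y hy.2)
    · rintro _ ⟨x, hx, rfl⟩ _ ⟨y, hy, rfl⟩
      have h1 := hst x hx.2 y hy.2
      exact (hflat x hx.1 y hy.1 (h1.trans hsσ)).trans (by gcongr)
  rw [Measure.hausdorffMeasure_apply]
  refine le_trans ?_ (mul_le_mul_right (le_iSup₂_of_le (ENNReal.ofReal σ)
    (ENNReal.ofReal_pos.2 hσ) le_rfl) _)
  have hC1 : ENNReal.ofReal C ≠ 0 := (ENNReal.ofReal_pos.2 hC0).ne'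
  simp_rw [ENNReal.mul_iInf_of_ne hC1 ENNReal.ofReal_ne_top]
  refine le_iInf₂ fun t ht ↦ le_iInf fun htσ ↦ ?_
  have hcov : g '' S ⊆ ⋃ k, g '' (S ∩ t k) := by
    rw [← image_iUnion, ← inter_iUnion]
    exact image_mono (subset_inter Subset.rfl ht)
  refine (measure_mono hcov).trans ((measure_iUnion_le _).trans ?_)
  rw [← ENNReal.tsum_mul_left]
  refine ENNReal.tsum_le_tsum fun k ↦ ?_
  rcases (t k).eq_empty_or_nonempty with h0 | h0
  · simp [h0]
  · rw [ciSup_pos h0, ENNReal.rpow_natCast]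
    exact key _ (htσ k)

end Content

section InjectiveRestriction

variable {X Y : Type*} [MetricSpace X] [MetricSpace Y] [MeasurableSpace Y] [BorelSpace Y]


/-- A continuous map on a compact set can be restricted to a compact set on which it is injective
while keeping the image of positive measure. -/
lemma exists_isCompact_injOn_measure_image_ne_zero (ν : Measure Y) [IsFiniteMeasureOnCompacts ν]
    {A : Set X} (hA : IsCompact A) {Φ : X → Y} (hΦ : ContinuousOn Φ A) (hpos : ν (Φ '' A) ≠ 0) :
    ∃ B ⊆ A, IsCompact B ∧ InjOn Φ B ∧ ν (Φ '' B) ≠ 0 := by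
  have hne : A.Nonempty := by
    by_contra h
    rw [not_nonempty_iff_eq_empty] at h
    simp [h] at hpos
  have : CompactSpace A := isCompact_iff_compactSpace.1 hA
  have : Nonempty A := hne.to_subtype
  obtain ⟨q₀, hq₀, hq₀s⟩ := exists_nat_bool_continuous_surjective_of_compact A
  obtain ⟨q, hq, hqA⟩ : ∃ q : cantorSet → X, Continuous q ∧ range q = A := by
    refine ⟨fun t ↦ q₀ (cantorSetHomeomorphNatToBool t), by fun_prop, ?_⟩
    have : (fun t ↦ (q₀ (cantorSetHomeomorphNatToBool t) : X)) =
        Subtype.val ∘ q₀ ∘ cantorSetHomeomorphNatToBool := rfl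
    rw [this, range_comp, (hq₀s.comp cantorSetHomeomorphNatToBool.surjective).range_eq]
    simp
  have hqm : ∀ t, q t ∈ A := fun t ↦ hqA ▸ mem_range_self t
  have : CompactSpace cantorSet := isCompact_iff_compactSpace.1 isCompact_cantorSet
  set h : cantorSet → Y := fun t ↦ Φ (q t) with hh
  have hcont : Continuous h := hΦ.comp_continuous hq hqm
  have hrange : range h = Φ '' A := by rw [← hqA, ← range_comp]; rfl
  set Z : Set Y := Φ '' A with hZ
  have hZc : IsCompact Z := hA.image_of_continuousOn hΦ
  -- the first point of each fibre
  have hmin : ∀ p ∈ Z, ∃ t, h t = p ∧ ∀ t', h t' = p → t ≤ t' := by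
    intro p hp
    rw [← hrange] at hp
    obtain ⟨t, ht, hle⟩ :=
      ((isClosed_singleton (x := p)).preimage hcont).isCompact.exists_isLeast hp
    exact ⟨t, ht, fun t' ht' ↦ hle ht'⟩
  have : Nonempty cantorSet := ⟨cantorSetHomeomorphNatToBool.symm fun _ ↦ true⟩
  choose! ψ hψ hψmin using hmin
  set ψ' : Z → ℝ := fun p ↦ ψ p with hψ'
  have hψm : Measurable ψ' := by
    refine measurable_of_Iic fun a ↦ ?_
    have : ψ' ⁻¹' Iic a = Subtype.val ⁻¹' (h '' {t | (t : ℝ) ≤ a}) := by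
      ext p
      constructor
      · intro hp
        exact ⟨ψ p, hp, hψ p p.2⟩
      · rintro ⟨t, ht, htp⟩
        exact (Subtype.coe_le_coe.2 (hψmin p p.2 t htp)).trans ht
    rw [this]
    have hc : IsCompact (h '' {t | (t : ℝ) ≤ a}) :=
      ((isClosed_le continuous_subtype_val continuous_const).isCompact).image hcont
    exact hc.isClosed.measurableSet.preimage measurable_subtype_coe
  have hψs : Measurable fun p : Z ↦ ψ p := hψm.subtype_mk (h := fun p ↦ (ψ p).2)
  set M : Set cantorSet := range fun p : Z ↦ ψ p with hM
  have hMeq : M = {t | ψ (h t) = t} := by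
    ext t
    constructor
    · rintro ⟨p, rfl⟩
      change ψ (h (ψ p)) = ψ p
      rw [hψ p p.2]
    · intro ht
      exact ⟨⟨h t, hrange ▸ mem_range_self t⟩, ht⟩
  have hMm : MeasurableSet M := by
    rw [hMeq]
    have h1 : Measurable fun t ↦ ψ (h t) :=
      hψs.comp (hcont.measurable.subtype_mk (h := fun t ↦ hrange ▸ mem_range_self t))
    exact measurableSet_eq_fun h1 measurable_id
  set ρ : Measure cantorSet := (ν.comap Subtype.val : Measure Z).map (fun p : Z ↦ ψ p) with hρ
  have hρapply : ∀ T, MeasurableSet T → ρ T = ν (Subtype.val '' ((fun p : Z ↦ ψ p) ⁻¹' T)) := by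
    intro T hT
    rw [hρ, Measure.map_apply hψs hT,
      (MeasurableEmbedding.subtype_coe hZc.isClosed.measurableSet).comap_apply]
  have hρfin : IsFiniteMeasure ρ := by
    refine ⟨?_⟩
    rw [hρapply _ MeasurableSet.univ]
    simpa using hZc.measure_lt_top
  have hρM : 0 < ρ M := by
    rw [hρapply _ hMm, pos_iff_ne_zero]
    have : (fun p : Z ↦ ψ p) ⁻¹' M = univ := eq_univ_of_forall fun p ↦ mem_range_self p
    rw [this]
    simpa using hpos
  obtain ⟨T, hTM, hTc, hT⟩ := hMm.exists_lt_isCompact hρM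
  refine ⟨q '' T, ?_, hTc.image hq, ?_, ?_⟩
  · rintro _ ⟨t, -, rfl⟩
    exact hqm t
  · rintro _ ⟨t, ht, rfl⟩ _ ⟨t', ht', rfl⟩ heq
    have h1 : ψ (h t) = t := by have := hTM ht; rwa [hMeq] at this
    have h2 : ψ (h t') = t' := by have := hTM ht'; rwa [hMeq] at this
    rw [← h1, ← h2]
    change q (ψ (Φ (q t))) = q (ψ (Φ (q t')))
    rw [heq]
  · refine ((hT.trans_le ?_)).ne'
    rw [hρapply _ hTc.measurableSet]
    refine measure_mono ?_
    rintro _ ⟨p, hp, rfl⟩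
    exact ⟨q (ψ p), mem_image_of_mem q hp, hψ p p.2⟩

end InjectiveRestriction

section Density

lemma ediam_closedBall_le_ofReal {X : Type*} [PseudoMetricSpace X] (x : X) (r : ℝ) :
    ediam (closedBall x r) ≤ ENNReal.ofReal (2 * r) := by
  refine ediam_le fun y hy z hz ↦ ?_
  rw [edist_dist]
  refine ENNReal.ofReal_le_ofReal ((dist_triangle_right y z x).trans ?_)
  linarith [mem_closedBall.1 hy, mem_closedBall.1 hz]

variable {X : Type*} [MetricSpace X] [MeasurableSpace X] [BorelSpace X]

/-- Almost every point of a closed set `B` is a point where the complement of `B` has zero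
upper `n`-density. -/
lemma ae_exists_measure_closedBall_diff_le {n : ℕ} (hn : n ≠ 0)
    (hfin : μH[n] (univ : Set X) < ∞) {B : Set X} (hB : IsClosed B) {ε : ℝ} (hε : 0 < ε) :
    μH[n] {x ∈ B | ¬ ∃ r₁ > (0 : ℝ), ∀ r, 0 < r → r ≤ r₁ →
      μH[n] (closedBall x r \ B) ≤ ENNReal.ofReal (ε * r ^ n)} = 0 := by
  set μ : Measure X := μH[n] with hμ
  have : IsFiniteMeasure μ := ⟨hfin⟩
  refine hausdorffMeasure_eq_zero_of_hausdorffContent hn ?_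
  set S : Set X := {x ∈ B | ¬ ∃ r₁ > (0 : ℝ), ∀ r, 0 < r → r ≤ r₁ →
    μ (closedBall x r \ B) ≤ ENNReal.ofReal (ε * r ^ n)} with hS
  set C : ℝ := 10 ^ n / ε with hC
  have key : ∀ η : ℝ≥0∞, 0 < η → hausdorffContent n X S ≤ ENNReal.ofReal C * η := by
    intro η hη
    obtain ⟨U, hBU, hUo, hU⟩ := B.exists_isOpen_lt_add (measure_ne_top μ B) hη.ne'
    have hUB : μ (U \ B) ≤ η := by
      rw [measure_sdiff hBU hB.measurableSet.nullMeasurableSet (measure_ne_top μ B)]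
      exact tsub_le_iff_left.2 hU.le
    have h1 : ∀ x ∈ S, ∃ r, 0 < r ∧ r ≤ 1 ∧ closedBall x r ⊆ U ∧
        ENNReal.ofReal (ε * r ^ n) < μ (closedBall x r \ B) := by
      intro x hx
      obtain ⟨r₀, hr₀, hr₀U⟩ := nhds_basis_closedBall.mem_iff.1 (hUo.mem_nhds (hBU hx.1))
      have h2 := hx.2
      push Not at h2
      obtain ⟨r, hr, hrle, hr2⟩ := h2 (min r₀ 1) (lt_min hr₀ one_pos)
      exact ⟨r, hr, hrle.trans (min_le_right _ _),
        (closedBall_subset_closedBall (hrle.trans (min_le_left _ _))).trans hr₀U, hr2⟩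
    choose! r hr0 hr1 hrU hr using h1
    obtain ⟨u, huS, hdisj, hcov⟩ := Vitali.exists_disjoint_subfamily_covering_enlargement_closedBall
      S id r 1 hr1 5 (by norm_num)
    have hmeas : ∀ i : u, MeasurableSet (closedBall (i : X) (r i) \ B) :=
      fun i ↦ isClosed_closedBall.measurableSet.diff hB.measurableSet
    have hdisj' : Pairwise (Function.onFun Disjoint fun i : u ↦ closedBall (i : X) (r i) \ B) :=
      fun i j hij ↦ (hdisj i.2 j.2 (fun h ↦ hij (Subtype.ext h))).mono sdiff_subset sdiff_subset
    have hcount : u.Countable := by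
      have h2 := Measure.countable_meas_pos_of_disjoint_iUnion (μ := μ) hmeas hdisj'
      have h3 : {i : u | 0 < μ (closedBall (i : X) (r i) \ B)} = univ :=
        eq_univ_of_forall fun i ↦ (zero_le).trans_lt (hr i (huS i.2))
      rw [h3] at h2
      exact countable_coe_iff.1 (countable_univ_iff.1 h2)
    have hSu : S ⊆ ⋃ x ∈ u, closedBall x (5 * r x) := by
      intro x hx
      obtain ⟨y, hy, hxy⟩ := hcov x hx
      exact mem_iUnion₂.2 ⟨y, hy, hxy (mem_closedBall_self (hr0 x hx).le)⟩
    have := hcount.to_subtype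
    calc hausdorffContent n X S ≤ hausdorffContent n X (⋃ x ∈ u, closedBall x (5 * r x)) :=
          measure_mono hSu
      _ ≤ ∑' x : u, hausdorffContent n X (closedBall x (5 * r x)) :=
          measure_biUnion_le _ hcount _
      _ ≤ ∑' x : u, ENNReal.ofReal C * μ (closedBall (x : X) (r x) \ B) := by
          refine ENNReal.tsum_le_tsum fun x ↦ (hausdorffContent_le_ediam_pow n _).trans ?_
          have hrx := hr0 x (huS x.2)
          calc _ ≤ (ENNReal.ofReal (10 * r x)) ^ n := by
                gcongr
                exact (ediam_closedBall_le_ofReal _ _).trans_eq (by ring_nf)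
            _ = ENNReal.ofReal C * ENNReal.ofReal (ε * r x ^ n) := by
                rw [← ENNReal.ofReal_mul (by positivity), ← ENNReal.ofReal_pow (by positivity), hC,
                  mul_pow]
                congr 1
                field_simp
            _ ≤ _ := by gcongr; exact (hr x (huS x.2)).le
      _ = ENNReal.ofReal C * ∑' x : u, μ (closedBall (x : X) (r x) \ B) := ENNReal.tsum_mul_left
      _ ≤ ENNReal.ofReal C * η := by
          gcongr
          refine (tsum_meas_le_meas_iUnion_of_disjoint μ hmeas hdisj').trans ?_
          refine (measure_mono (iUnion_subset fun x ↦ ?_)).trans hUB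
          exact sdiff_subset_sdiff_left (hrU x (huS x.2))
  have hlim : Tendsto (fun η ↦ ENNReal.ofReal C * η) (𝓝[>] 0) (𝓝 (ENNReal.ofReal C * 0)) :=
    (ENNReal.Tendsto.const_mul tendsto_id (Or.inr ENNReal.ofReal_ne_top)).mono_left
      nhdsWithin_le_nhds
  rw [mul_zero] at hlim
  have : (𝓝[>] (0 : ℝ≥0∞)).NeBot := nhdsGT_neBot_of_exists_gt ⟨1, one_pos⟩
  exact nonpos_iff_eq_zero.1 (ge_of_tendsto hlim (eventually_mem_nhdsWithin.mono key))

end Density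

section Filling

variable {X : Type*} [MetricSpace X]

lemma exists_closedBall_disjoint_of_notMem_image {n : ℕ} {K B : Set X} {r₀ C M : ℝ}
    (hC : 1 ≤ C) (hM : 0 ≤ M) {Φ : X → Fin n → ℝ}
    (hΦ : ∀ x y, dist (Φ x) (Φ y) ≤ C * dist x y) (hB : IsCompact B)
    (hR : ∀ z ∈ B, ∀ p, dist p (Φ z) ≤ r₀ →
      ∃ y ∈ K, dist z y ≤ M * dist p (Φ z) ∧ dist (Φ y) p ≤ dist p (Φ z) / 4)
    {x : X} (hx : x ∈ B) {r : ℝ} (hr₀ : r ≤ r₀) {p : Fin n → ℝ} (hp : dist p (Φ x) ≤ r)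
    (hpB : p ∉ Φ '' (B ∩ closedBall x ((2 * M + 2) * r))) :
    ∃ ρ, 0 < ρ ∧ ρ ≤ r ∧ ∃ y ∈ K,
      closedBall y (ρ / (4 * C)) ⊆ closedBall x ((2 * M + 2) * r) \ B ∧
      MapsTo Φ (closedBall y (ρ / (4 * C))) (closedBall p ρ) := by
  have hΦc : Continuous Φ := (LipschitzWith.of_dist_le_mul (K := C.toNNReal) fun x y ↦ by
    rw [Real.coe_toNNReal C (by linarith)]; exact hΦ x y).continuous
  obtain ⟨z, hz, hzmin⟩ := hB.exists_isMinOn ⟨x, hx⟩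
    (f := fun z ↦ (2 * M + 2) * dist p (Φ z) + dist x z) (by fun_prop)
  have hzx : (2 * M + 2) * dist p (Φ z) + dist x z ≤ (2 * M + 2) * r := by
    have := hzmin hx
    simp only [mem_ofPred_eq, dist_self, add_zero] at this
    exact this.trans (by gcongr)
  set ρ := dist p (Φ z) with hρ
  have hρ0 : 0 < ρ := by
    refine lt_of_le_of_ne dist_nonneg fun h ↦ hpB ⟨z, ⟨hz, ?_⟩, ?_⟩
    · rw [mem_closedBall']
      rw [← h] at hzx
      linarith
    · exact (dist_eq_zero.1 h.symm).symm
  have hρr : ρ ≤ r := by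
    have h1 : (2 * M + 2) * ρ ≤ (2 * M + 2) * r := by linarith [dist_nonneg (x := x) (y := z)]
    exact le_of_mul_le_mul_left h1 (by linarith)
  obtain ⟨y, hyK, hzy, hyp⟩ := hR z hz p (hρr.trans hr₀)
  have hκ : ρ / (4 * C) ≤ ρ / 4 := by gcongr; linarith
  have hCκ : C * (ρ / (4 * C)) = ρ / 4 := by field_simp
  have hdist : ∀ w ∈ closedBall y (ρ / (4 * C)), dist p (Φ w) ≤ ρ / 2 := by
    intro w hw
    have h1 := dist_triangle p (Φ y) (Φ w)
    have h2 : dist (Φ y) (Φ w) ≤ ρ / 4 :=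
      (hΦ y w).trans ((mul_le_mul_of_nonneg_left (mem_closedBall'.1 hw) (by linarith)).trans_eq hCκ)
    rw [dist_comm] at hyp
    linarith
  refine ⟨ρ, hρ0, hρr, y, hyK, fun w hw ↦ ⟨?_, fun hwB ↦ ?_⟩, fun w hw ↦ ?_⟩
  · rw [mem_closedBall']
    have h1 := dist_triangle4 x z y w
    have h2 := mem_closedBall'.1 hw
    nlinarith
  · have h0 := hzmin hwB
    simp only [mem_ofPred_eq] at h0
    have h1 := dist_triangle4 x z y w
    have h2 := mem_closedBall'.1 hw
    have h3 := hdist w hw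
    nlinarith
  · rw [mem_closedBall']
    linarith [hdist w hw]

variable [MeasurableSpace X] [BorelSpace X]

lemma volume_closedBall_diff_image_le {n : ℕ} {K B : Set X} {c r₀ C M ε : ℝ} (hc : 0 < c)
    (hC : 1 ≤ C) (hM : 0 ≤ M)
    (hK : ∀ y ∈ K, ∀ r, 0 < r → r ≤ r₀ → ENNReal.ofReal (c * r ^ n) ≤ μH[n] (closedBall y r))
    {Φ : X → Fin n → ℝ} (hΦ : ∀ x y, dist (Φ x) (Φ y) ≤ C * dist x y) (hB : IsCompact B)
    (hR : ∀ z ∈ B, ∀ p, dist p (Φ z) ≤ r₀ →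
      ∃ y ∈ K, dist z y ≤ M * dist p (Φ z) ∧ dist (Φ y) p ≤ dist p (Φ z) / 4)
    {x : X} (hx : x ∈ B) {r : ℝ} (hr : 0 < r) (hr₀ : r ≤ r₀)
    (hxB : μH[n] (closedBall x ((2 * M + 2) * r) \ B) ≤
      ENNReal.ofReal (ε * ((2 * M + 2) * r) ^ n)) :
    volume (closedBall (Φ x) r \ Φ '' (B ∩ closedBall x ((2 * M + 2) * r))) ≤
      ENNReal.ofReal ((40 * C * (2 * M + 2)) ^ n / c * ε * r ^ n) := by
  set H := closedBall (Φ x) r \ Φ '' (B ∩ closedBall x ((2 * M + 2) * r)) with hH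
  have h1 : ∀ p ∈ H, ∃ ρ, 0 < ρ ∧ ρ ≤ r ∧ ∃ y ∈ K,
      closedBall y (ρ / (4 * C)) ⊆ closedBall x ((2 * M + 2) * r) \ B ∧
      MapsTo Φ (closedBall y (ρ / (4 * C))) (closedBall p ρ) := fun p hp ↦
    exists_closedBall_disjoint_of_notMem_image hC hM hΦ hB hR hx hr₀ hp.1 hp.2
  have : Nonempty X := ⟨x⟩
  choose! ρ hρ0 hρr y hyK hyB hyΦ using h1
  obtain ⟨u, huH, hdisj, hcov⟩ := Vitali.exists_disjoint_subfamily_covering_enlargement_closedBall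
    H id ρ r hρr 5 (by norm_num)
  have hcount : u.Countable := hdisj.countable_of_nonempty_interior fun p hp ↦
    ⟨p, ball_subset_interior_closedBall (mem_ball_self (hρ0 p (huH hp)))⟩
  have hHu : H ⊆ ⋃ p ∈ u, closedBall p (5 * ρ p) := by
    intro p hp
    obtain ⟨q, hq, hpq⟩ := hcov p hp
    exact mem_iUnion₂.2 ⟨q, hq, hpq (mem_closedBall_self (hρ0 p hp).le)⟩
  have := hcount.to_subtype
  have hdisj' : Pairwise (Function.onFun Disjoint
      fun p : u ↦ closedBall (y p) (ρ p / (4 * C))) := by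
    intro p q hpq
    have h2 := hdisj p.2 q.2 (fun h ↦ hpq (Subtype.ext h))
    refine Disjoint.of_image (f := Φ) (h2.mono ?_ ?_)
    · exact (hyΦ p (huH p.2)).image_subset
    · exact (hyΦ q (huH q.2)).image_subset
  have hr0 : 0 < r₀ := hr.trans_le hr₀
  calc volume H ≤ volume (⋃ p ∈ u, closedBall p (5 * ρ p)) := measure_mono hHu
    _ ≤ ∑' p : u, volume (closedBall (p : Fin n → ℝ) (5 * ρ p)) := measure_biUnion_le _ hcount _
    _ ≤ ∑' p : u, ENNReal.ofReal ((40 * C) ^ n / c) *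
          μH[n] (closedBall (y p) (ρ p / (4 * C))) := by
        refine ENNReal.tsum_le_tsum fun p ↦ ?_
        have hρp := hρ0 p (huH p.2)
        rw [Real.volume_pi_closedBall _ (by positivity), Fintype.card_fin]
        calc _ = ENNReal.ofReal ((40 * C) ^ n / c) *
              ENNReal.ofReal (c * (ρ p / (4 * C)) ^ n) := by
              rw [← ENNReal.ofReal_mul (by positivity)]
              congr 1
              have h3 : 2 * (5 * ρ p) = 40 * C * (ρ p / (4 * C)) := by
                field_simp
                ring
              rw [h3, mul_pow]
              field_simp
          _ ≤ _ := by
              gcongr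
              refine hK _ (hyK p (huH p.2)) _ (by positivity) ?_
              refine (div_le_self hρp.le (by linarith)).trans ((hρr p (huH p.2)).trans hr₀)
    _ = ENNReal.ofReal ((40 * C) ^ n / c) * ∑' p : u, μH[n] (closedBall (y p) (ρ p / (4 * C))) :=
        ENNReal.tsum_mul_left
    _ ≤ ENNReal.ofReal ((40 * C) ^ n / c) * ENNReal.ofReal (ε * ((2 * M + 2) * r) ^ n) := by
        gcongr
        refine (tsum_meas_le_meas_iUnion_of_disjoint _
          (fun p ↦ isClosed_closedBall.measurableSet) hdisj').trans (le_trans ?_ hxB)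
        exact measure_mono (iUnion_subset fun p ↦ hyB p (huH p.2))
    _ = _ := by
        rw [← ENNReal.ofReal_mul (by positivity)]
        congr 1
        rw [mul_pow, mul_pow, mul_pow]
        ring

end Filling

section Rectifiability

variable {X : Type*} [MetricSpace X] [MeasurableSpace X] [BorelSpace X]

lemma isRectifiableSet_of_antilipschitz {n : ℕ} {B : Set X} (hB : IsCompact B)
    (hne : B.Nonempty) {Φ : X → Fin n → ℝ} (hΦ : ContinuousOn Φ B) {L : ℝ≥0}
    (hL : ∀ x ∈ B, ∀ y ∈ B, dist x y ≤ L * dist (Φ x) (Φ y)) : IsRectifiableSet n B := by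
  have : Nonempty X := hne.to_type
  refine ⟨hB.isClosed.measurableSet, fun _ ↦ WithLp.ofLp ⁻¹' (Φ '' B),
    fun _ p ↦ Function.invFunOn Φ B (WithLp.ofLp p), fun _ ↦ ?_, fun _ ↦ ⟨L, ?_⟩, ?_⟩
  · exact ((hB.image_of_continuousOn hΦ).isClosed.preimage
      (PiLp.continuous_ofLp 2 _)).measurableSet
  · refine LipschitzOnWith.of_dist_le_mul fun p hp q hq ↦ ?_
    refine (hL _ (Function.invFunOn_mem hp) _ (Function.invFunOn_mem hq)).trans ?_
    rw [Function.invFunOn_eq hp, Function.invFunOn_eq hq]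
    gcongr
    simpa using (PiLp.lipschitzWith_ofLp 2 (fun _ : Fin n ↦ ℝ)).dist_le_mul p q
  · convert measure_empty (μ := (μH[n] : Measure X))
    rw [sdiff_eq_empty]
    intro x hx
    have hmem : Φ x ∈ Φ '' B := mem_image_of_mem Φ hx
    refine mem_iUnion.2 ⟨0, WithLp.toLp 2 (Φ x), hmem, ?_⟩
    have h1 := hL _ (Function.invFunOn_mem hmem) x hx
    rw [Function.invFunOn_eq hmem, dist_self, mul_zero] at h1
    exact dist_le_zero.1 h1

variable {n : ℕ} {K : Set X} {c r₀ C M : ℝ} {Φ : X → Fin n → ℝ}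

lemma measure_setOf_not_filling_eq_zero (hn : n ≠ 0) (hfin : μH[n] (univ : Set X) < ∞)
    (hc : 0 < c) (hr₀ : 0 < r₀) (hC : 1 ≤ C) (hM : 0 ≤ M)
    (hK : ∀ y ∈ K, ∀ r, 0 < r → r ≤ r₀ → ENNReal.ofReal (c * r ^ n) ≤ μH[n] (closedBall y r))
    (hΦ : ∀ x y, dist (Φ x) (Φ y) ≤ C * dist x y) {B : Set X} (hB : IsCompact B)
    (hR : ∀ z ∈ B, ∀ p, dist p (Φ z) ≤ r₀ →
      ∃ y ∈ K, dist z y ≤ M * dist p (Φ z) ∧ dist (Φ y) p ≤ dist p (Φ z) / 4) :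
    μH[n] {x ∈ B | ¬ ∃ r₁ > (0 : ℝ), ∀ r, 0 < r → r ≤ r₁ →
      volume (closedBall (Φ x) r \ Φ '' (B ∩ closedBall x ((2 * M + 2) * r))) ≤
        ENNReal.ofReal (r ^ n / 4)} = 0 := by
  set D := (40 * C * (2 * M + 2)) ^ n / c with hD
  have hD0 : 0 < D := by positivity
  refine measure_mono_null ?_ (ae_exists_measure_closedBall_diff_le hn hfin hB.isClosed
    (show 0 < 1 / (4 * D) by positivity))
  rintro x ⟨hx, hx'⟩
  refine ⟨hx, fun ⟨r₁, hr₁, h⟩ ↦ hx' ⟨min r₀ (r₁ / (2 * M + 2)), by positivity, fun r hr hrle ↦ ?_⟩⟩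
  have h1 : (2 * M + 2) * r ≤ r₁ := by
    have := hrle.trans (min_le_right _ _)
    rwa [le_div_iff₀ (by positivity), mul_comm] at this
  refine (volume_closedBall_diff_image_le hc hC hM hK hΦ hB hR hx hr (hrle.trans (min_le_left _ _))
    (h _ (by positivity) h1)).trans_eq ?_
  rw [← hD]
  congr 1
  field_simp

lemma volume_image_ne_zero_of_filling (hn : n ≠ 0) (hfin : μH[n] (univ : Set X) < ∞)
    (hc : 0 < c) (hr₀ : 0 < r₀) (hC : 1 ≤ C) (hM : 0 ≤ M)
    (hK : ∀ y ∈ K, ∀ r, 0 < r → r ≤ r₀ → ENNReal.ofReal (c * r ^ n) ≤ μH[n] (closedBall y r))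
    (hΦ : ∀ x y, dist (Φ x) (Φ y) ≤ C * dist x y) {B : Set X} (hB : IsCompact B)
    (hR : ∀ z ∈ B, ∀ p, dist p (Φ z) ≤ r₀ →
      ∃ y ∈ K, dist z y ≤ M * dist p (Φ z) ∧ dist (Φ y) p ≤ dist p (Φ z) / 4)
    (hμ : μH[n] B ≠ 0) : volume (Φ '' B) ≠ 0 := by
  intro h0
  refine hμ (measure_mono_null (fun x hx ↦ ?_)
    (measure_setOf_not_filling_eq_zero hn hfin hc hr₀ hC hM hK hΦ hB hR))
  refine ⟨hx, ?_⟩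
  rintro ⟨r, hr, h⟩
  have h1 := h r hr le_rfl
  rw [measure_sdiff_null (measure_mono_null (image_mono inter_subset_left) h0),
    Real.volume_pi_closedBall _ hr.le, Fintype.card_fin,
    ENNReal.ofReal_le_ofReal_iff (by positivity), mul_pow] at h1
  have h2 : (1 : ℝ) ≤ 2 ^ n := one_le_pow₀ (by norm_num)
  have h3 : 0 < r ^ n := by positivity
  nlinarith

lemma exists_isRectifiableSet_of_filling (hn : n ≠ 0) (hfin : μH[n] (univ : Set X) < ∞)
    (hc : 0 < c) (hr₀ : 0 < r₀) (hC : 1 ≤ C) (hM : 0 ≤ M)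
    (hK : ∀ y ∈ K, ∀ r, 0 < r → r ≤ r₀ → ENNReal.ofReal (c * r ^ n) ≤ μH[n] (closedBall y r))
    (hΦ : ∀ x y, dist (Φ x) (Φ y) ≤ C * dist x y) {B : Set X} (hB : IsCompact B)
    (hR : ∀ z ∈ B, ∀ p, dist p (Φ z) ≤ r₀ →
      ∃ y ∈ K, dist z y ≤ M * dist p (Φ z) ∧ dist (Φ y) p ≤ dist p (Φ z) / 4)
    (hμ : μH[n] B ≠ 0) (hinj : InjOn Φ B) : ∃ B' : Set X, IsRectifiableSet n B' ∧ μH[n] B' ≠ 0 := by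
  have hΦc : Continuous Φ := (LipschitzWith.of_dist_le_mul (K := C.toNNReal) fun x y ↦ by
    rw [Real.coe_toNNReal C (by linarith)]; exact hΦ x y).continuous
  set G : ℕ → Set X := fun j ↦ {x ∈ B | ∀ r, 0 < r → r ≤ 1 / ((j : ℝ) + 1) →
      volume (closedBall (Φ x) r \ Φ '' (B ∩ closedBall x ((2 * M + 2) * r))) ≤
        ENNReal.ofReal (r ^ n / 4)} with hG
  obtain ⟨j, hj⟩ : ∃ j, μH[n] (G j) ≠ 0 := by
    by_contra! h
    refine hμ (measure_mono_null (fun x hx ↦ ?_) (measure_union_null (measure_iUnion_null h)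
      (measure_setOf_not_filling_eq_zero hn hfin hc hr₀ hC hM hK hΦ hB hR)))
    by_cases hx' : ∃ r₁ > (0 : ℝ), ∀ r, 0 < r → r ≤ r₁ →
      volume (closedBall (Φ x) r \ Φ '' (B ∩ closedBall x ((2 * M + 2) * r))) ≤
        ENNReal.ofReal (r ^ n / 4)
    · obtain ⟨r₁, hr₁, h1⟩ := hx'
      obtain ⟨j, hj⟩ := exists_nat_one_div_lt hr₁
      exact Or.inl (mem_iUnion.2 ⟨j, hx, fun r hr hrj ↦ h1 r hr (hrj.trans hj.le)⟩)
    · exact Or.inr ⟨hx, hx'⟩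
  set r₁ : ℝ := 1 / ((j : ℝ) + 1) with hr₁
  have hr₁0 : 0 < r₁ := by positivity
  have hclose : ∀ x ∈ G j, ∀ y ∈ G j, dist (Φ x) (Φ y) ≤ r₁ / 2 →
      dist x y ≤ (6 * M + 6) * dist (Φ x) (Φ y) := by
    intro x hx y hy hxy
    set s := dist (Φ x) (Φ y) with hs
    rcases (dist_nonneg (x := Φ x) (y := Φ y)).eq_or_lt with h0 | h0
    · rw [hinj hx.1 hy.1 (dist_eq_zero.1 h0.symm), dist_self]
      positivity
    have hx1 := hx.2 s h0 (by linarith)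
    have hy1 := hy.2 (2 * s) (by linarith) (by linarith)
    have hlt : volume ((closedBall (Φ x) s \ Φ '' (B ∩ closedBall x ((2 * M + 2) * s))) ∪
        (closedBall (Φ y) (2 * s) \ Φ '' (B ∩ closedBall y ((2 * M + 2) * (2 * s))))) <
        volume (closedBall (Φ x) s) := by
      refine ((measure_union_le _ _).trans (add_le_add hx1 hy1)).trans_lt ?_
      rw [Real.volume_pi_closedBall _ h0.le, Fintype.card_fin,
        ← ENNReal.ofReal_add (by positivity) (by positivity),
        ENNReal.ofReal_lt_ofReal_iff (by positivity), mul_pow]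
      have h2 : (1 : ℝ) ≤ 2 ^ n := one_le_pow₀ (by norm_num)
      have h3 : 0 < s ^ n := by positivity
      nlinarith
    obtain ⟨p, hp, hp'⟩ : ∃ p ∈ closedBall (Φ x) s,
        p ∉ (closedBall (Φ x) s \ Φ '' (B ∩ closedBall x ((2 * M + 2) * s))) ∪
        (closedBall (Φ y) (2 * s) \ Φ '' (B ∩ closedBall y ((2 * M + 2) * (2 * s)))) := by
      by_contra! h
      exact hlt.not_ge (measure_mono h)
    have hpy : p ∈ closedBall (Φ y) (2 * s) := by
      have := dist_triangle p (Φ x) (Φ y)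
      rw [mem_closedBall] at hp ⊢
      linarith
    obtain ⟨z, hz, hzp⟩ : p ∈ Φ '' (B ∩ closedBall x ((2 * M + 2) * s)) := by
      by_contra h
      exact hp' (Or.inl ⟨hp, h⟩)
    obtain ⟨w, hw, hwp⟩ : p ∈ Φ '' (B ∩ closedBall y ((2 * M + 2) * (2 * s))) := by
      by_contra h
      exact hp' (Or.inr ⟨hpy, h⟩)
    have hzw : z = w := hinj hz.1 hw.1 (hzp.trans hwp.symm)
    subst hzw
    have h4 := dist_triangle_left x y z
    have h5 := mem_closedBall.1 hz.2
    have h6 := mem_closedBall.1 hw.2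
    linarith
  set L : ℝ := max (6 * M + 6) (diam B / (r₁ / 2)) with hL
  have hL0 : 0 ≤ L := le_max_of_le_left (by positivity)
  have hanti : ∀ x ∈ G j, ∀ y ∈ G j, dist x y ≤ L * dist (Φ x) (Φ y) := by
    intro x hx y hy
    rcases le_total (dist (Φ x) (Φ y)) (r₁ / 2) with h | h
    · exact (hclose x hx y hy h).trans (by gcongr; exact le_max_left _ _)
    · calc dist x y ≤ diam B := dist_le_diam_of_mem hB.isBounded hx.1 hy.1
        _ = diam B / (r₁ / 2) * (r₁ / 2) := by field_simp
        _ ≤ L * dist (Φ x) (Φ y) := by gcongr; exact le_max_right _ _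
  have hsub : closure (G j) ⊆ B := closure_minimal (fun x hx ↦ hx.1) hB.isClosed
  have hμ' : μH[n] (closure (G j)) ≠ 0 := fun h ↦ hj (measure_mono_null subset_closure h)
  refine ⟨closure (G j), ?_, hμ'⟩
  refine isRectifiableSet_of_antilipschitz (hB.of_isClosed_subset isClosed_closure hsub)
    (nonempty_of_measure_ne_zero hμ') hΦc.continuousOn (L := ⟨L, hL0⟩) fun x hx y hy ↦ ?_
  have hclosed : IsClosed {q : X × X | dist q.1 q.2 ≤ L * dist (Φ q.1) (Φ q.2)} :=
    isClosed_le (by fun_prop) (by fun_prop)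
  have hmem : (x, y) ∈ closure (G j ×ˢ G j) := by
    rw [closure_prod_eq]; exact ⟨hx, hy⟩
  exact closure_minimal (fun q hq ↦ hanti q.1 hq.1 q.2 hq.2) hclosed hmem

/-- In a purely unrectifiable space, a compact set on which some Lipschitz map to `ℝⁿ` fills small
balls approximately is null. -/
lemma measure_eq_zero_of_filling (hn : n ≠ 0) (hfin : μH[n] (univ : Set X) < ∞)
    (hunrect : ∀ E : Set X, IsRectifiableSet n E → μH[n] E = 0)
    (hc : 0 < c) (hr₀ : 0 < r₀) (hC : 1 ≤ C) (hM : 0 ≤ M)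
    (hK : ∀ y ∈ K, ∀ r, 0 < r → r ≤ r₀ → ENNReal.ofReal (c * r ^ n) ≤ μH[n] (closedBall y r))
    (hΦ : ∀ x y, dist (Φ x) (Φ y) ≤ C * dist x y) {A : Set X} (hA : IsCompact A)
    (hR : ∀ z ∈ A, ∀ p, dist p (Φ z) ≤ r₀ →
      ∃ y ∈ K, dist z y ≤ M * dist p (Φ z) ∧ dist (Φ y) p ≤ dist p (Φ z) / 4) :
    μH[n] A = 0 := by
  by_contra hμ
  have hΦl : LipschitzWith C.toNNReal Φ := LipschitzWith.of_dist_le_mul fun x y ↦ by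
    rw [Real.coe_toNNReal C (by linarith)]; exact hΦ x y
  obtain ⟨B, hBA, hB, hinj, hvol⟩ := exists_isCompact_injOn_measure_image_ne_zero volume hA
    hΦl.continuous.continuousOn
    (volume_image_ne_zero_of_filling hn hfin hc hr₀ hC hM hK hΦ hA hR hμ)
  have hμB : μH[n] B ≠ 0 := by
    intro h0
    refine hvol ?_
    have h1 := (hΦl.lipschitzOnWith (s := B)).hausdorffMeasure_image_le (d := n) (by positivity)
    rw [h0, mul_zero] at h1
    rw [← hausdorffMeasure_pi_real, Fintype.card_fin]
    exact nonpos_iff_eq_zero.1 h1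
  obtain ⟨B', hB', hμB'⟩ := exists_isRectifiableSet_of_filling hn hfin hc hr₀ hC hM hK hΦ hB
    (fun z hz ↦ hR z (hBA hz)) hμB hinj
  exact hμB' (hunrect B' hB')

end Rectifiability

section Directions

/-- Almost every point of a measurable set of reals is approximated by the set at small scales. -/
lemma ae_eventually_exists_mem_abs_sub_le {F : Set ℝ} (hF : MeasurableSet F) {α : ℝ}
    (hα : 0 < α) :
    ∀ᵐ t, t ∈ F → ∀ᶠ τ in 𝓝[≠] (0 : ℝ), ∃ s ∈ F, |s - (t + τ)| ≤ α * |τ| := by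
  have h := IsUnifLocDoublingMeasure.ae_tendsto_measure_inter_div (volume : Measure ℝ) F (1 / α)
  rw [ae_restrict_iff' hF] at h
  filter_upwards [h] with t ht htF
  have hlim : Tendsto (fun τ : ℝ ↦ α * |τ|) (𝓝[≠] 0) (𝓝[>] 0) := by
    refine tendsto_nhdsWithin_iff.2 ⟨?_, eventually_mem_nhdsWithin.mono fun τ hτ ↦ ?_⟩
    · have : Continuous fun τ : ℝ ↦ α * |τ| := by fun_prop
      simpa using (this.tendsto 0).mono_left nhdsWithin_le_nhds
    · exact mul_pos hα (abs_pos.2 hτ)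
  have h1 := ht htF (fun τ ↦ t + τ) (fun τ ↦ α * |τ|) hlim (Eventually.of_forall fun τ ↦ by
    rw [mem_closedBall, Real.dist_eq, ← mul_assoc, one_div_mul_cancel hα.ne']
    simp)
  filter_upwards [h1.eventually (lt_mem_nhds zero_lt_one)] with τ hτ
  have h2 : (F ∩ closedBall (t + τ) (α * |τ|)).Nonempty := by
    rw [nonempty_iff_ne_empty]
    intro h0
    simp [h0] at hτ
  obtain ⟨s, hs, hs'⟩ := h2
  exact ⟨s, hs, by rwa [mem_closedBall, Real.dist_eq] at hs'⟩

variable {X : Type*} [MetricSpace X]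
variable {E : Type*} [NormedAddCommGroup E] [InnerProductSpace ℝ E]

/-- The set of points of `A` from which one can move inside `A`, at scales up to `δ`, so that `φ`
approximately moves in direction `v`. -/
def directionSet (φ : X → E) (A : Set X) (θ δ : ℝ) (v : E) : Set X :=
  {x ∈ A | ∀ τ : ℝ, |τ| ≤ δ → ∃ y ∈ A, dist x y ≤ 2 * |τ| ∧ ‖φ y - φ x - τ • v‖ ≤ θ * |τ|}

lemma isCompact_directionSet {φ : X → E} (hφ : Continuous φ) {A : Set X} (hA : IsCompact A)
    (θ δ : ℝ) (v : E) : IsCompact (directionSet φ A θ δ v) := by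
  have h : directionSet φ A θ δ v = A ∩ ⋂ (τ : ℝ) (_ : |τ| ≤ δ), Prod.fst '' ((A ×ˢ A) ∩
      {p : X × X | dist p.1 p.2 ≤ 2 * |τ| ∧ ‖φ p.2 - φ p.1 - τ • v‖ ≤ θ * |τ|}) := by
    ext x
    simp only [directionSet, mem_ofPred_eq, mem_inter_iff, mem_iInter, mem_image, mem_prod,
      Prod.exists, exists_and_right, exists_eq_right]
    constructor
    · rintro ⟨hx, h⟩
      exact ⟨hx, fun τ hτ ↦ (h τ hτ).imp fun y hy ↦ ⟨⟨hx, hy.1⟩, hy.2⟩⟩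
    · rintro ⟨hx, h⟩
      exact ⟨hx, fun τ hτ ↦ (h τ hτ).imp fun y hy ↦ ⟨hy.1.2, hy.2⟩⟩
  rw [h]
  refine hA.inter_right (isClosed_biInter fun τ _ ↦ ?_)
  have hclosed : IsClosed
      {p : X × X | dist p.1 p.2 ≤ 2 * |τ| ∧ ‖φ p.2 - φ p.1 - τ • v‖ ≤ θ * |τ|} :=
    IsClosed.and (isClosed_le (by fun_prop) (by fun_prop)) (isClosed_le (by fun_prop) (by fun_prop))
  exact (((hA.prod hA).inter_right hclosed).image continuous_fst).isClosed

variable [FiniteDimensional ℝ E]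

/-- Removing from a set all points from which one can move in a direction transversal to `V`
leaves a set that is flat with respect to `V` along fragments. -/
lemma fragmentFlat_of_disjoint_directionSet {φ : X → E} (hφ : LipschitzWith 1 φ) {A N : Set X}
    (hNA : N ⊆ A) {θ lam : ℝ} (hθ : 0 < θ) (hθ1 : θ ≤ 1) (hlam : 0 < lam) {W : Set E}
    (hW : Dense W) {V : Submodule ℝ E}
    (hN : ∀ v ∈ W, ‖v‖ ≤ 2 → (∃ w ∈ Vᗮ, ‖w‖ = 1 ∧ lam ≤ inner ℝ w v) →
      ∀ k : ℕ, Disjoint N (directionSet φ A θ (1 / ((k : ℝ) + 1)) v)) :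
    FragmentFlat φ N V (2 * lam) := by
  intro w hw hw1 F γ hF hγ hγN
  set g : ℝ → E := fun t ↦ φ (γ t) with hg
  have hgF : LipschitzOnWith 1 g F := by
    have := hφ.comp_lipschitzOnWith hγ
    rwa [one_mul] at this
  filter_upwards [hgF.ae_differentiableWithinAt_of_mem (μ := volume),
    ae_eventually_exists_mem_abs_sub_le hF.measurableSet (show 0 < θ / 8 by positivity)]
    with t hdiff hnear htF ε hε
  have hderiv := (hdiff htF).hasDerivWithinAt
  set v := derivWithin g F t with hv
  have hlin : ∀ c > 0, ∀ᶠ s in 𝓝[F] t, ‖g s - g t - (s - t) • v‖ ≤ c * |s - t| := by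
    intro c hc
    exact (hasDerivWithinAt_iff_isLittleO.1 hderiv).def hc
  rcases le_or_gt (inner ℝ w v) (2 * lam) with hwv | hwv
  · have h1 := hlin ε hε
    filter_upwards [nhdsWithin_mono t inter_subset_left h1, eventually_mem_nhdsWithin] with s hs hsF
    have hst : 0 < s - t := sub_pos.2 hsF.2
    have h2 : inner ℝ w (g s) - inner ℝ w (g t) =
        inner ℝ w (g s - g t - (s - t) • v) + (s - t) * inner ℝ w v := by
      rw [inner_sub_right, inner_sub_right, inner_smul_right]
      ring
    have h3 := real_inner_le_norm w (g s - g t - (s - t) • v)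
    rw [hw1, one_mul] at h3
    rw [abs_of_pos hst] at hs
    change inner ℝ w (g s) - inner ℝ w (g t) ≤ _
    rw [h2]
    nlinarith
  · rcases eq_or_neBot (𝓝[F ∩ Ioi t] t) with hbot | hbot
    · simp [hbot]
    exfalso
    have hv1 : ‖v‖ ≤ 5 / 4 := by
      obtain ⟨s, hs, hsF⟩ := (((hlin (1 / 4) (by norm_num)).filter_mono
        (nhdsWithin_mono t inter_subset_left)).and
        (eventually_mem_nhdsWithin (s := F ∩ Ioi t) (a := t))).exists
      have hst : 0 < s - t := sub_pos.2 hsF.2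
      have h1 := hgF.dist_le_mul s hsF.1 t htF
      rw [dist_eq_norm, Real.dist_eq, NNReal.coe_one, one_mul] at h1
      have h2 : ‖(s - t) • v‖ ≤ ‖g s - g t‖ + ‖g s - g t - (s - t) • v‖ := by
        have := norm_sub_le (g s - g t) (g s - g t - (s - t) • v)
        rwa [sub_sub_cancel] at this
      rw [norm_smul, Real.norm_eq_abs] at h2
      rw [abs_of_pos hst] at h1 h2 hs
      have h3 : (s - t) * ‖v‖ ≤ (s - t) * (5 / 4) := by linarith
      exact le_of_mul_le_mul_left h3 hst
    obtain ⟨v₀, hv₀W, hv₀⟩ := hW.exists_dist_lt v (show 0 < min (θ / 4) lam by positivity)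
    rw [dist_eq_norm, lt_min_iff] at hv₀
    have hv₀2 : ‖v₀‖ ≤ 2 := by
      have := norm_sub_norm_le v₀ v
      rw [norm_sub_rev] at this
      linarith [hv₀.1]
    have hwv₀ : lam ≤ inner ℝ w v₀ := by
      have h1 := real_inner_le_norm w (v - v₀)
      rw [hw1, one_mul, inner_sub_right] at h1
      linarith [hv₀.2]
    obtain ⟨η, hη, hη1⟩ := Metric.mem_nhdsWithin_iff.1 (hlin (θ / 4) (by positivity))
    obtain ⟨η', hη', hη1'⟩ := Metric.mem_nhdsWithin_iff.1 (hnear htF)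
    obtain ⟨k, hk⟩ := exists_nat_one_div_lt (show 0 < min (η / 2) η' by positivity)
    rw [lt_min_iff] at hk
    refine disjoint_left.1 (hN v₀ hv₀W hv₀2 ⟨w, hw, hw1, hwv₀⟩ k) (hγN htF)
      ⟨hNA (hγN htF), fun τ hτ ↦ ?_⟩
    rcases eq_or_ne τ 0 with rfl | hτ0
    · exact ⟨γ t, hNA (hγN htF), by simp, by simp⟩
    have hτpos := abs_pos.2 hτ0
    obtain ⟨s, hsF, hs⟩ :=
      hη1' ⟨show τ ∈ ball 0 η' by rw [mem_ball, Real.dist_eq, sub_zero]; linarith, hτ0⟩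
    have hst : |s - t| ≤ 9 / 8 * |τ| := by
      have h1 := abs_add_le (s - (t + τ)) τ
      rw [show s - (t + τ) + τ = s - t by ring] at h1
      nlinarith
    have hlins : ‖g s - g t - (s - t) • v‖ ≤ θ / 4 * |s - t| :=
      hη1 ⟨show s ∈ ball t η by rw [mem_ball, Real.dist_eq]; linarith, hsF⟩
    refine ⟨γ s, hNA (hγN hsF), ?_, ?_⟩
    · have h1 := hγ.dist_le_mul t htF s hsF
      rw [NNReal.coe_one, one_mul, dist_comm t, Real.dist_eq] at h1
      linarith
    · have h1 : φ (γ s) - φ (γ t) - τ • v₀ =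
          (g s - g t - (s - t) • v) + (s - t) • (v - v₀) + (s - (t + τ)) • v₀ := by
        simp only [hg]
        module
      rw [h1]
      refine (norm_add₃_le).trans ?_
      rw [norm_smul, norm_smul, Real.norm_eq_abs, Real.norm_eq_abs]
      have h2 : |s - t| * ‖v - v₀‖ ≤ |s - t| * (θ / 4) := by
        gcongr
        exact hv₀.1.le
      have h3 : |s - (t + τ)| * ‖v₀‖ ≤ θ / 8 * |τ| * 2 := by gcongr
      have h4 : θ / 2 * |s - t| ≤ θ / 2 * (9 / 8 * |τ|) := by gcongr
      nlinarith [mul_pos hθ hτpos]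

end Directions

section Decomposition

variable {X : Type*} [MetricSpace X]
variable {E : Type*} [NormedAddCommGroup E] [InnerProductSpace ℝ E]

/-- From every point of `A` one can move inside `K`, at scales up to `r₀`, so that `φ`
approximately moves along any given combination of the vectors `v i`. -/
def HasDirections (φ : X → E) (K A : Set X) (θ r₀ : ℝ) {j : ℕ} (v : Fin j → E) : Prop :=
  ∀ x ∈ A, ∀ τ : Fin j → ℝ, (∀ i, |τ i| ≤ r₀) →
    ∃ y ∈ K, dist x y ≤ 2 * ∑ i, |τ i| ∧ ‖φ y - φ x - ∑ i, τ i • v i‖ ≤ θ * ∑ i, |τ i|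

lemma hasDirections_zero {φ : X → E} {K : Set X} {θ r₀ : ℝ} (v : Fin 0 → E) :
    HasDirections φ K K θ r₀ v :=
  fun x hx τ _ ↦ ⟨x, hx, by simp, by simp⟩

lemma HasDirections.snoc {φ : X → E} {K A : Set X} {θ r₀ δ : ℝ} {j : ℕ} {v : Fin j → E}
    (h : HasDirections φ K A θ r₀ v) (u : E) :
    HasDirections φ K (directionSet φ A θ δ u) θ (min r₀ δ) (Fin.snoc v u : Fin (j + 1) → E) := by
  rintro x ⟨-, hx⟩ τ hτ
  obtain ⟨z, hz, hxz, hφz⟩ := hx (τ (Fin.last j)) ((hτ _).trans (min_le_right _ _))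
  obtain ⟨y, hy, hzy, hφy⟩ := h z hz (fun i ↦ τ i.castSucc) fun i ↦
    (hτ _).trans (min_le_left _ _)
  refine ⟨y, hy, ?_, ?_⟩
  · rw [Fin.sum_univ_castSucc]
    linarith [dist_triangle x z y]
  · simp only [Fin.sum_univ_castSucc, Fin.snoc_castSucc, Fin.snoc_last]
    have h1 := norm_add_le (φ y - φ z - ∑ i : Fin j, τ i.castSucc • v i)
      (φ z - φ x - τ (Fin.last j) • u)
    rw [show φ y - φ x - (∑ i : Fin j, τ i.castSucc • v i + τ (Fin.last j) • u) =
      (φ y - φ z - ∑ i : Fin j, τ i.castSucc • v i) + (φ z - φ x - τ (Fin.last j) • u) by abel]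
    linarith

/-- Adding a vector transversal to the span of a quantitatively independent family keeps it
quantitatively independent. -/
lemma abs_le_mul_norm_sum_snoc {j : ℕ} {v : Fin j → E} {u : E} {C lam : ℝ} (hlam : 0 < lam)
    (hC : 1 / lam ≤ C) (hv : ∀ (t : Fin j → ℝ) i, |t i| ≤ C * ‖∑ l, t l • v l‖) (hu : ‖u‖ ≤ 2)
    {w : E} (hw : w ∈ (Submodule.span ℝ (range v))ᗮ) (hw1 : ‖w‖ = 1) (hwu : lam ≤ inner ℝ w u)
    (t : Fin (j + 1) → ℝ) (i : Fin (j + 1)) :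
    |t i| ≤ C * (1 + 2 / lam) * ‖∑ l, t l • (Fin.snoc v u : Fin (j + 1) → E) l‖ := by
  simp only [Fin.sum_univ_castSucc, Fin.snoc_castSucc, Fin.snoc_last]
  set s := t (Fin.last j)
  set e := ∑ l : Fin j, t l.castSucc • v l with he
  have hwe : inner ℝ w e = 0 := by
    refine Submodule.inner_left_of_mem_orthogonal (K := Submodule.span ℝ (range v)) ?_ hw
    exact Submodule.sum_mem _ fun l _ ↦
      Submodule.smul_mem _ _ (Submodule.subset_span (mem_range_self l))
  have hC0 : 0 ≤ C := le_trans (by positivity) hC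
  have hs : |s| ≤ 1 / lam * ‖e + s • u‖ := by
    have h1 : |inner ℝ w (e + s • u)| ≤ ‖e + s • u‖ := by
      simpa [hw1] using abs_real_inner_le_norm w (e + s • u)
    rw [inner_add_right, hwe, zero_add, inner_smul_right, abs_mul] at h1
    rw [one_div, ← div_eq_inv_mul, le_div_iff₀ hlam]
    refine le_trans ?_ h1
    gcongr
    exact hwu.trans (le_abs_self _)
  have hee : ‖e‖ ≤ (1 + 2 / lam) * ‖e + s • u‖ := by
    have h1 := norm_sub_le (e + s • u) (s • u)
    rw [add_sub_cancel_right, norm_smul, Real.norm_eq_abs] at h1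
    have h2 : |s| * ‖u‖ ≤ 1 / lam * ‖e + s • u‖ * 2 := by gcongr
    calc ‖e‖ ≤ ‖e + s • u‖ + 1 / lam * ‖e + s • u‖ * 2 := by linarith
      _ = _ := by ring
  induction i using Fin.lastCases with
  | last =>
    refine hs.trans ?_
    gcongr
    exact hC.trans (le_mul_of_one_le_right hC0 (by linarith [show 0 < 2 / lam by positivity]))
  | cast i =>
    refine (hv (fun l ↦ t l.castSucc) i).trans ?_
    rw [mul_assoc]
    gcongr

variable [MeasurableSpace X] [BorelSpace X]

/-- `A` is covered, up to a null set, by countably many measurable sets, each of which is flat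
along fragments with respect to some subspace of dimension less than `n`. -/
def FlatDecomposable (φ : X → E) (n : ℕ) (lam : ℝ) (A : Set X) : Prop :=
  ∃ 𝒮 : Set (Set X), 𝒮.Countable ∧
    (∀ S ∈ 𝒮, MeasurableSet S ∧
      ∃ V : Submodule ℝ E, Module.finrank ℝ V < n ∧ FragmentFlat φ S V lam) ∧
    μH[n] (A \ ⋃₀ 𝒮) = 0

lemma FlatDecomposable.of_null {φ : X → E} {n : ℕ} {lam : ℝ} {A : Set X} (hA : μH[n] A = 0) :
    FlatDecomposable φ n lam A :=
  ⟨∅, countable_empty, by simp, by simpa using hA⟩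

lemma FlatDecomposable.of_flat {φ : X → E} {n : ℕ} {lam : ℝ} {A : Set X} (hA : MeasurableSet A)
    {V : Submodule ℝ E} (hV : Module.finrank ℝ V < n) (h : FragmentFlat φ A V lam) :
    FlatDecomposable φ n lam A :=
  ⟨{A}, countable_singleton A, by rintro S rfl; exact ⟨hA, V, hV, h⟩, by simp⟩

lemma FlatDecomposable.of_subset_iUnion {φ : X → E} {n : ℕ} {lam : ℝ} {ι : Type*} [Countable ι]
    {A : Set X} {B : ι → Set X} (hAB : A ⊆ ⋃ i, B i) (h : ∀ i, FlatDecomposable φ n lam (B i)) :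
    FlatDecomposable φ n lam A := by
  choose 𝒮 hc hS h0 using h
  refine ⟨⋃ i, 𝒮 i, countable_iUnion hc, fun S hS' ↦ ?_, ?_⟩
  · obtain ⟨i, hi⟩ := mem_iUnion.1 hS'
    exact hS i S hi
  · refine measure_mono_null (fun x hx ↦ ?_) (measure_iUnion_null h0)
    obtain ⟨i, hi⟩ := mem_iUnion.1 (hAB hx.1)
    exact mem_iUnion.2 ⟨i, hi, fun h' ↦ hx.2 (sUnion_mono (subset_iUnion 𝒮 i) h')⟩

/-- A quantitatively independent family admits a bounded coordinate map. -/
lemma exists_linearMap_coordinates {n : ℕ} {v : Fin n → E} {C : ℝ} (hC : 0 ≤ C)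
    (hv : ∀ (t : Fin n → ℝ) i, |t i| ≤ C * ‖∑ l, t l • v l‖) :
    ∃ T : E →ₗ[ℝ] (Fin n → ℝ), (∀ t : Fin n → ℝ, T (∑ l, t l • v l) = t) ∧
      ∀ e, ‖T e‖ ≤ C * ‖e‖ := by
  set S := Fintype.linearCombination ℝ v with hS
  have hSt : ∀ t, S t = ∑ l, t l • v l := fun t ↦ Fintype.linearCombination_apply ℝ v t
  have hinj : Function.Injective S := by
    refine (injective_iff_map_eq_zero S).2 fun t ht ↦ funext fun i ↦ ?_
    have h1 := hv t i
    rw [← hSt, ht, norm_zero, mul_zero] at h1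
    exact abs_nonpos_iff.1 h1
  set L := LinearEquiv.ofInjective S hinj with hL
  have hLv : ∀ z : LinearMap.range S, ‖L.symm z‖ ≤ C * ‖(z : E)‖ := by
    intro z
    rw [pi_norm_le_iff_of_nonneg (by positivity)]
    intro i
    have h1 := hv (L.symm z) i
    rwa [← hSt, ← LinearEquiv.ofInjective_apply (h := hinj), ← hL, LinearEquiv.apply_symm_apply]
      at h1
  refine ⟨L.symm.toLinearMap ∘ₗ
    ((LinearMap.range S).orthogonalProjectionOnto : E →L[ℝ] LinearMap.range S).toLinearMap,
    fun t ↦ ?_, fun e ↦ ?_⟩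
  · rw [← hSt]
    change L.symm ((LinearMap.range S).orthogonalProjectionOnto (S t)) = t
    rw [LinearEquiv.symm_apply_eq]
    exact (LinearMap.range S).orthogonalProjectionOnto_mem_subspace_eq_self (L t)
  · refine (hLv _).trans ?_
    gcongr
    exact (LinearMap.range S).norm_orthogonalProjectionOnto_apply_le e

variable {n : ℕ} {K : Set X} {c r₀ : ℝ} {φ : X → E}

/-- In a purely `n`-unrectifiable space, the points from which one can move in `n` independent
directions form a null set. -/
lemma measure_eq_zero_of_hasDirections (hn : n ≠ 0) (hfin : μH[n] (univ : Set X) < ∞)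
    (hunrect : ∀ E : Set X, IsRectifiableSet n E → μH[n] E = 0) (hc : 0 < c) (hr₀ : 0 < r₀)
    (hK : ∀ y ∈ K, ∀ r, 0 < r → r ≤ r₀ → ENNReal.ofReal (c * r ^ n) ≤ μH[n] (closedBall y r))
    (hφ : LipschitzWith 1 φ) {A : Set X} (hA : IsCompact A) {v : Fin n → E} {C θ r₁ : ℝ}
    (hC : 0 ≤ C) (hθ : n * θ * C ≤ 1 / 4) (hθ0 : 0 ≤ θ) (hr₁ : 0 < r₁)
    (hv : ∀ (t : Fin n → ℝ) i, |t i| ≤ C * ‖∑ l, t l • v l‖)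
    (h : HasDirections φ K A θ r₁ v) : μH[n] A = 0 := by
  obtain ⟨T, hTv, hT⟩ := exists_linearMap_coordinates hC hv
  refine measure_eq_zero_of_filling (K := K) (c := c) (r₀ := min r₀ r₁) (C := max 1 C)
    (M := 2 * n) (Φ := fun x ↦ T (φ x)) hn hfin hunrect hc (lt_min hr₀ hr₁) (le_max_left _ _)
    (by positivity) (fun y hy r hr hr' ↦ hK y hy r hr (hr'.trans (min_le_left _ _)))
    (fun x y ↦ ?_) hA fun z hz p hp ↦ ?_
  · rw [dist_eq_norm, ← map_sub]
    refine (hT _).trans ?_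
    have := hφ.dist_le_mul x y
    rw [NNReal.coe_one, one_mul, dist_eq_norm] at this
    gcongr
    exact le_max_right _ _
  · set τ := p - T (φ z) with hτ
    have hd : dist p (T (φ z)) = ‖τ‖ := dist_eq_norm _ _
    rw [hd] at hp ⊢
    have hτi : ∀ i, |τ i| ≤ ‖τ‖ := fun i ↦ norm_le_pi_norm τ i
    have hsum : ∑ i, |τ i| ≤ n * ‖τ‖ := by
      simpa using Finset.sum_le_card_nsmul Finset.univ (fun i ↦ |τ i|) ‖τ‖ fun i _ ↦ hτi i
    obtain ⟨y, hy, hzy, hφy⟩ := h z hz τ fun i ↦ (hτi i).trans (hp.trans (min_le_right _ _))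
    refine ⟨y, hy, by linarith, ?_⟩
    have h1 : T (φ y) - p = T (φ y - φ z - ∑ i, τ i • v i) := by
      rw [map_sub, map_sub, hTv, hτ]
      abel
    rw [dist_eq_norm, h1]
    calc _ ≤ C * (θ * (n * ‖τ‖)) := (hT _).trans (by gcongr; exact hφy.trans (by gcongr))
      _ = n * θ * C * ‖τ‖ := by ring
      _ ≤ 1 / 4 * ‖τ‖ := by gcongr
      _ = _ := by ring

variable [FiniteDimensional ℝ E]

/-- In a purely `n`-unrectifiable space, a set from which one can move in some independent
directions is decomposed into pieces that are flat along fragments. -/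
lemma flatDecomposable_of_hasDirections (hn : n ≠ 0) (hfin : μH[n] (univ : Set X) < ∞)
    (hunrect : ∀ E : Set X, IsRectifiableSet n E → μH[n] E = 0) (hc : 0 < c) (hr₀ : 0 < r₀)
    (hK : ∀ y ∈ K, ∀ r, 0 < r → r ≤ r₀ → ENNReal.ofReal (c * r ^ n) ≤ μH[n] (closedBall y r))
    (hφ : LipschitzWith 1 φ) {lam θ : ℝ} (hlam : 0 < lam) (hθ : 0 < θ) (hθ1 : θ ≤ 1)
    (hθn : n * θ * (1 / lam * (1 + 2 / lam) ^ n) ≤ 1 / 4) (k : ℕ) :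
    ∀ {j : ℕ}, j + k = n → ∀ {A : Set X}, IsCompact A → ∀ {v : Fin j → E} {r₁ : ℝ}, 0 < r₁ →
      (∀ (t : Fin j → ℝ) i, |t i| ≤ 1 / lam * (1 + 2 / lam) ^ j * ‖∑ l, t l • v l‖) →
      HasDirections φ K A θ r₁ v → FlatDecomposable φ n (2 * lam) A := by
  induction k with
  | zero =>
    rintro j rfl A hA v r₁ hr₁ hv h
    exact .of_null (measure_eq_zero_of_hasDirections hn hfin hunrect hc hr₀ hK hφ hA
      (by positivity) hθn hθ.le hr₁ hv h)
  | succ k ih =>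
    intro j hj A hA v r₁ hr₁ hv h
    obtain ⟨W, hWc, hW⟩ := TopologicalSpace.exists_countable_dense E
    set V := Submodule.span ℝ (range v) with hV
    set W' := {u | u ∈ W ∧ ‖u‖ ≤ 2 ∧ ∃ w ∈ Vᗮ, ‖w‖ = 1 ∧ lam ≤ inner ℝ w u} with hW'
    have : Countable W' := (hWc.mono fun u hu ↦ hu.1).to_subtype
    set D : W' × ℕ → Set X := fun q ↦ directionSet φ A θ (1 / ((q.2 : ℝ) + 1)) q.1 with hD
    have hDc : ∀ q, IsCompact (D q) := fun q ↦ isCompact_directionSet hφ.continuous hA _ _ _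
    set N := A \ ⋃ q, D q with hN
    refine .of_subset_iUnion (B := fun o : Option (W' × ℕ) ↦ o.elim N D) (fun x hx ↦ ?_) ?_
    · by_cases hxD : x ∈ ⋃ q, D q
      · obtain ⟨q, hq⟩ := mem_iUnion.1 hxD
        exact mem_iUnion.2 ⟨some q, hq⟩
      · exact mem_iUnion.2 ⟨none, hx, hxD⟩
    rintro (_ | ⟨⟨u, hu, hu2, w, hw, hw1, hwu⟩, i⟩)
    · refine .of_flat (V := V) (hA.measurableSet.diff
        (MeasurableSet.iUnion fun q ↦ (hDc q).measurableSet)) ?_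
        (fragmentFlat_of_disjoint_directionSet hφ sdiff_subset hθ hθ1 hlam hW
          fun u hu hu2 hw i ↦ ?_)
      · refine (finrank_range_le_card v).trans_lt ?_
        rw [Fintype.card_fin]
        omega
      · exact disjoint_left.2 fun x hx hx' ↦ hx.2 (mem_iUnion.2 ⟨(⟨u, hu, hu2, hw⟩, i), hx'⟩)
    · refine ih (j := j + 1) (by omega) (hDc _) (lt_min hr₁ (by positivity)) ?_ (h.snoc u)
      intro t l
      rw [pow_succ, ← mul_assoc]
      refine abs_le_mul_norm_sum_snoc hlam ?_ hv hu2 hw hw1 hwu t l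
      refine le_mul_of_one_le_right (by positivity) (one_le_pow₀ ?_)
      linarith [show 0 < 2 / lam by positivity]

/-- In a purely `n`-unrectifiable space, a compact set of positive lower density is decomposed into
pieces that are flat along fragments with arbitrarily small slope. -/
theorem flatDecomposable_of_isCompact (hn : n ≠ 0) (hfin : μH[n] (univ : Set X) < ∞)
    (hunrect : ∀ E : Set X, IsRectifiableSet n E → μH[n] E = 0) (hc : 0 < c) (hr₀ : 0 < r₀)
    (hK : ∀ y ∈ K, ∀ r, 0 < r → r ≤ r₀ → ENNReal.ofReal (c * r ^ n) ≤ μH[n] (closedBall y r))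
    (hφ : LipschitzWith 1 φ) {lam : ℝ} (hlam : 0 < lam) (hKc : IsCompact K) :
    FlatDecomposable φ n lam K := by
  obtain ⟨l, rfl⟩ : ∃ l, lam = 2 * l := ⟨lam / 2, by ring⟩
  have hl : 0 < l := by linarith
  set C := 1 / l * (1 + 2 / l) ^ n with hC
  have hn0 : 0 < (n : ℝ) := by positivity
  have hC0 : 0 < C := by positivity
  refine flatDecomposable_of_hasDirections hn hfin hunrect hc hr₀ hK hφ hl
    (θ := min 1 (1 / (4 * n * C))) (by positivity) (min_le_left _ _) ?_ n (zero_add n) hKc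
    (v := Fin.elim0) one_pos (fun t i ↦ i.elim0) (hasDirections_zero _)
  calc n * min 1 (1 / (4 * n * C)) * C ≤ n * (1 / (4 * n * C)) * C := by
        gcongr; exact min_le_right _ _
    _ = 1 / 4 := by field_simp

end Decomposition

section Assembly

/-- A space of finite Hausdorff measure is separable. -/
lemma secondCountableTopology_of_hausdorffMeasure_lt_top {X : Type*} [MetricSpace X]
    [MeasurableSpace X] [BorelSpace X] {d : ℝ} (h : μH[d] (univ : Set X) < ∞) :
    SecondCountableTopology X := by
  refine EMetric.secondCountable_of_almost_dense_set fun ε hε ↦ ?_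
  rw [Measure.hausdorffMeasure_apply] at h
  have h1 := (le_iSup₂ (f := fun (r : ℝ≥0∞) (_ : 0 < r) ↦ ⨅ (t : ℕ → Set X)
    (_ : univ ⊆ ⋃ n, t n) (_ : ∀ n, ediam (t n) ≤ r),
      ∑' n, ⨆ _ : (t n).Nonempty, ediam (t n) ^ d) ε hε).trans_lt h
  simp only [iInf_lt_iff] at h1
  obtain ⟨t, ht, htε, -⟩ := h1
  refine ⟨⋃ (k : ℕ) (hk : (t k).Nonempty), {hk.some}, ?_, eq_univ_of_forall fun x ↦ ?_⟩
  · exact countable_iUnion fun k ↦ countable_iUnion fun hk ↦ countable_singleton _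
  · obtain ⟨k, hk⟩ := mem_iUnion.1 (ht (mem_univ x))
    have hne : (t k).Nonempty := ⟨x, hk⟩
    refine mem_iUnion₂.2 ⟨hne.some, mem_iUnion₂.2 ⟨k, hne, rfl⟩, ?_⟩
    exact (edist_le_ediam_of_mem hk hne.some_mem).trans (htε k)

lemma exists_forall_ofReal_le_measure_closedBall {X : Type*} [MetricSpace X] [MeasurableSpace X]
    {μ : Measure X} {n : ℕ} {x : X}
    (hx : 0 < liminf (fun r : ℝ ↦ μ (closedBall x r) / ENNReal.ofReal (r ^ n)) (𝓝[>] 0)) :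
    ∃ j : ℕ, ∀ r : ℝ, 0 < r → r ≤ 1 / ((j : ℝ) + 1) →
      ENNReal.ofReal (1 / ((j : ℝ) + 1) * r ^ n) ≤ μ (closedBall x r) := by
  obtain ⟨c, hc0, hc⟩ := exists_between hx
  have h1 := eventually_lt_of_lt_liminf hc
  obtain ⟨u, hu, hu'⟩ := mem_nhdsGT_iff_exists_Ioo_subset.1 h1
  have hctop : c ≠ ∞ := hc.ne_top
  obtain ⟨j, hj⟩ := exists_nat_one_div_lt
    (show 0 < min u c.toReal from lt_min hu (ENNReal.toReal_pos hc0.ne' hctop))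
  rw [lt_min_iff] at hj
  refine ⟨j, fun r hr hrj ↦ ?_⟩
  rw [ENNReal.ofReal_mul (by positivity)]
  refine le_trans ?_ (ENNReal.mul_le_of_le_div (hu' ⟨hr, hrj.trans_lt hj.1⟩ : c < _).le)
  gcongr
  exact ENNReal.ofReal_le_of_le_toReal hj.2.le

variable {X : Type*} [MetricSpace X] [MeasurableSpace X] [BorelSpace X]

/-- If a finite measure has positive lower density almost everywhere, then there are compact sets
of almost full measure on which the lower density bound is uniform. -/
lemma exists_isCompact_measure_compl_lt_of_liminf_pos [CompleteSpace X]
    [SecondCountableTopology X] {μ : Measure X} [IsFiniteMeasure μ] {n : ℕ}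
    (hld : ∀ᵐ x ∂μ,
      0 < liminf (fun r : ℝ ↦ μ (closedBall x r) / ENNReal.ofReal (r ^ n)) (𝓝[>] 0))
    {ε : ℝ≥0∞} (hε : ε ≠ 0) :
    ∃ (K : Set X) (c r₀ : ℝ), IsCompact K ∧ μ Kᶜ < ε ∧ 0 < c ∧ 0 < r₀ ∧
      ∀ y ∈ K, ∀ r, 0 < r → r ≤ r₀ → ENNReal.ofReal (c * r ^ n) ≤ μ (closedBall y r) := by
  set D : ℕ → Set X := fun j ↦ {x | ∀ r : ℝ, 0 < r → r ≤ 1 / ((j : ℝ) + 1) →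
    ENNReal.ofReal (1 / ((j : ℝ) + 1) * r ^ n) ≤ μ (closedBall x r)} with hD
  have hDmono : Monotone D := fun i j hij x hx r hr hrj ↦ by
    have h1 : 1 / ((j : ℝ) + 1) ≤ 1 / ((i : ℝ) + 1) := by gcongr
    exact le_trans (by gcongr) (hx r hr (hrj.trans h1))
  have hclmono : Antitone fun j ↦ (closure (D j))ᶜ :=
    fun i j hij ↦ compl_subset_compl.2 (closure_mono (hDmono hij))
  have hnull : μ (⋂ j, (closure (D j))ᶜ) = 0 := by
    refine measure_mono_null (fun x hx ↦ ?_) hld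
    intro h
    obtain ⟨j, hj⟩ := exists_forall_ofReal_le_measure_closedBall h
    exact mem_iInter.1 hx j (subset_closure hj)
  have hlim := tendsto_measure_iInter_atTop (μ := μ)
    (fun j ↦ (isClosed_closure (s := D j)).measurableSet.compl.nullMeasurableSet) hclmono
    ⟨0, measure_ne_top _ _⟩
  rw [hnull] at hlim
  obtain ⟨j, hj⟩ := (hlim.eventually (gt_mem_nhds (ENNReal.half_pos hε))).exists
  obtain ⟨K, hKD, hK, hμK⟩ := (isClosed_closure (s := D j)).measurableSet.exists_isCompact_sdiff_lt
    (measure_ne_top μ _) (ENNReal.half_pos hε).ne'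
  refine ⟨K, 1 / ((j : ℝ) + 1) * (1 / 2) ^ n, 1 / ((j : ℝ) + 1), hK, ?_, by positivity,
    by positivity, fun y hy r hr hrj ↦ ?_⟩
  · calc μ Kᶜ ≤ μ ((closure (D j))ᶜ ∪ closure (D j) \ K) := by
          refine measure_mono fun x hx ↦ ?_
          by_cases h : x ∈ closure (D j)
          · exact .inr ⟨h, hx⟩
          · exact .inl h
      _ ≤ μ (closure (D j))ᶜ + μ (closure (D j) \ K) := measure_union_le _ _
      _ < ε / 2 + ε / 2 := ENNReal.add_lt_add hj hμK
      _ = ε := ENNReal.add_halves ε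
  · obtain ⟨x, hx, hxy⟩ := Metric.mem_closure_iff.1 (hKD hy) (r / 2) (by positivity)
    rw [mul_assoc, ← mul_pow, one_div_mul_eq_div 2 r]
    refine (hx (r / 2) (by positivity) (by linarith)).trans (measure_mono ?_)
    refine closedBall_subset_closedBall' ?_
    rw [dist_comm]
    linarith

/-- If a map sends a compact set to a set of small Hausdorff content and the complement of this set
is small, then all nearby `1`-Lipschitz maps have ranges of small Hausdorff content. -/
lemma exists_forall_hausdorffContent_range_lt {n : ℕ} {Y : Type*} [MetricSpace Y]
    [MeasurableSpace Y] [BorelSpace Y]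
    {g : X → Y} (hg : Continuous g) {A : Set X} (hA : IsCompact A) {δ : ℝ≥0∞}
    (hAμ : μH[n] Aᶜ < δ) (hgA : hausdorffContent n Y (g '' A) < δ) :
    ∃ ρ > 0, ∀ g' : X → Y, LipschitzWith 1 g' → (∀ x, dist (g' x) (g x) < ρ) →
      hausdorffContent n Y (range g') < δ + δ := by
  obtain ⟨U, hU, hgU, hUδ⟩ := exists_isOpen_hausdorffContent_lt hgA
  obtain ⟨ρ, hρ, hρU⟩ := (hA.image hg).exists_thickening_subset_open hU hgU
  refine ⟨ρ, hρ, fun g' hg' hdist ↦ ?_⟩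
  have hsub : range g' ⊆ U ∪ g' '' Aᶜ := by
    rintro _ ⟨x, rfl⟩
    by_cases hx : x ∈ A
    · exact .inl (hρU (mem_thickening_iff.2 ⟨g x, mem_image_of_mem g hx, hdist x⟩))
    · exact .inr (mem_image_of_mem g' hx)
  have himg : μH[n] (g' '' Aᶜ) ≤ μH[n] Aᶜ := by
    simpa using hg'.hausdorffMeasure_image_le (d := n) (by positivity) Aᶜ
  calc hausdorffContent n Y (range g')
      ≤ hausdorffContent n Y U + hausdorffContent n Y (g' '' Aᶜ) :=
        (measure_mono hsub).trans (measure_union_le _ _)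
    _ < δ + δ := ENNReal.add_lt_add hUδ
        (((hausdorffContent_le_hausdorffMeasure n _).trans himg).trans_lt hAμ)

variable {E : Type*} [NormedAddCommGroup E] [InnerProductSpace ℝ E]

/-- A decomposition into countably many flat pieces gives finitely many disjoint compact flat pieces
covering all but a small part. -/
lemma FlatDecomposable.exists_isCompact_pairwise_disjoint [CompleteSpace X]
    [SecondCountableTopology X] {n : ℕ} [IsFiniteMeasure (μH[n] : Measure X)]
    {φ : X → E} {lam : ℝ} {A : Set X} (h : FlatDecomposable φ n lam A) {ε : ℝ≥0∞}
    (hA : μH[n] Aᶜ < ε) :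
    ∃ (N : ℕ) (S : Fin N → Set X) (V : Fin N → Submodule ℝ E), (∀ i, IsCompact (S i)) ∧
      Pairwise (Function.onFun Disjoint S) ∧ (∀ i, Module.finrank ℝ (V i) < n) ∧
      (∀ i, FragmentFlat φ (S i) (V i) lam) ∧ μH[n] (⋃ i, S i)ᶜ < ε := by
  obtain ⟨𝒮, hc, hS, h0⟩ := h
  have hcompl : μH[n] (⋃₀ 𝒮)ᶜ < ε := by
    refine lt_of_le_of_lt ?_ hA
    calc μH[n] (⋃₀ 𝒮)ᶜ ≤ μH[n] (Aᶜ ∪ A \ ⋃₀ 𝒮) := by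
          refine measure_mono fun x hx ↦ ?_
          by_cases h : x ∈ A
          · exact .inr ⟨h, hx⟩
          · exact .inl h
      _ ≤ _ := (measure_union_le _ _).trans (by rw [h0, add_zero])
  rcases 𝒮.eq_empty_or_nonempty with rfl | hne
  · refine ⟨0, fun _ ↦ ∅, fun _ ↦ ⊥, fun i ↦ i.elim0, fun i ↦ i.elim0, fun i ↦ i.elim0,
      fun i ↦ i.elim0, by simpa using hcompl⟩
  obtain ⟨f, rfl⟩ := hc.exists_eq_range hne
  rw [forall_mem_range] at hS
  choose hmeas V hV hflat using hS
  have hdm : ∀ i, MeasurableSet (disjointed f i) := fun i ↦ MeasurableSet.disjointed hmeas i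
  rw [sUnion_range, ← iUnion_disjointed] at hcompl
  have hlim := tendsto_measure_iInter_atTop (μ := (μH[n] : Measure X))
    (s := fun N ↦ (⋃ i < N, disjointed f i)ᶜ)
    (fun N ↦ (MeasurableSet.biUnion (to_countable _) fun i _ ↦ hdm i).compl.nullMeasurableSet)
    (fun N M hNM ↦ compl_subset_compl.2
      (biUnion_mono (fun i (hi : i < N) ↦ hi.trans_le hNM) fun _ _ ↦ Subset.rfl))
    ⟨0, measure_ne_top _ _⟩
  rw [← compl_iUnion, biUnion_lt_eq_iUnion] at hlim
  obtain ⟨N, hN⟩ := (hlim.eventually (gt_mem_nhds hcompl)).exists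
  obtain ⟨δ, hδ, hδ'⟩ := ENNReal.exists_pos_sum_of_countable' (tsub_pos_of_lt hN).ne' (Fin N)
  have hcpt : ∀ i : Fin N, ∃ K ⊆ disjointed f i, IsCompact K ∧ μH[n] (disjointed f i \ K) < δ i :=
    fun i ↦ (hdm i).exists_isCompact_sdiff_lt (measure_ne_top _ _) (hδ i).ne'
  choose S hSf hSc hSμ using hcpt
  refine ⟨N, S, fun i ↦ V i, hSc, fun i j hij ↦ ?_, fun i ↦ hV i, fun i ↦ ?_, ?_⟩
  · exact (disjoint_disjointed f (Fin.val_injective.ne hij)).mono (hSf i) (hSf j)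
  · exact (hflat i).mono ((hSf i).trans (disjointed_subset f i))
  · calc μH[n] (⋃ i, S i)ᶜ
        ≤ μH[n] ((⋃ i < N, disjointed f i)ᶜ ∪ ⋃ i : Fin N, disjointed f i \ S i) := by
          refine measure_mono fun x hx ↦ ?_
          by_cases h : x ∈ ⋃ i < N, disjointed f i
          · obtain ⟨i, hi, hxi⟩ := mem_iUnion₂.1 h
            exact .inr (mem_iUnion.2 ⟨⟨i, hi⟩, hxi, fun h' ↦ hx (mem_iUnion.2 ⟨_, h'⟩)⟩)
          · exact .inl h
      _ ≤ μH[n] (⋃ i < N, disjointed f i)ᶜ + ∑' i, δ i := by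
          refine (measure_union_le _ _).trans ?_
          gcongr
          exact (measure_iUnion_le _).trans (ENNReal.tsum_le_tsum fun i ↦ (hSμ i).le)
      _ < _ := by
          rw [add_comm]
          exact lt_tsub_iff_right.1 hδ'

variable [FiniteDimensional ℝ E]

/-- A `K`-Lipschitz map with `K < 1` can be approximated by `1`-Lipschitz maps sending a large
compact set to a set of small Hausdorff content. -/
lemma exists_approx_hausdorffContent_image_lt [CompleteSpace X] {n : ℕ} (hn : n ≠ 0)
    (hunrect : ∀ E : Set X, IsRectifiableSet n E → μH[n] E = 0)
    (hfin : μH[n] (univ : Set X) < ∞)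
    (hld : ∀ᵐ x ∂(μH[n] : Measure X),
      0 < liminf (fun r : ℝ ↦ μH[n] (closedBall x r) / ENNReal.ofReal (r ^ n)) (𝓝[>] 0))
    {φ : X → E} {K : ℝ} (hK : K < 1) (hφ : ∀ x y, ‖φ x - φ y‖ ≤ K * dist x y)
    {ε : ℝ} (hε : 0 < ε) {δ : ℝ≥0∞} (hδ : δ ≠ 0) :
    ∃ (g : X → E) (A : Set X), LipschitzWith 1 g ∧ (∀ x, ‖g x - φ x‖ ≤ ε) ∧ IsCompact A ∧
      μH[n] Aᶜ < δ ∧ hausdorffContent n E (g '' A) < δ := by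
  have := secondCountableTopology_of_hausdorffMeasure_lt_top hfin
  have : IsFiniteMeasure (μH[n] : Measure X) := ⟨hfin⟩
  have hφ1 : LipschitzWith 1 φ := LipschitzWith.of_dist_le_mul fun x y ↦ by
    rw [dist_eq_norm, NNReal.coe_one]
    exact (hφ x y).trans (by gcongr)
  set m := Module.finrank ℝ E with hm
  set C : ℝ := 3 ^ n * (3 * (m + 1)) ^ n with hC
  have hC0 : 0 ≤ C := by positivity
  have hlim : Tendsto (fun lam : ℝ ↦ ENNReal.ofReal (C * lam) * μH[n] (univ : Set X)) (𝓝[>] 0)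
      (𝓝 0) := by
    have h1 : Tendsto (fun lam : ℝ ↦ ENNReal.ofReal (C * lam)) (𝓝[>] 0) (𝓝 0) := by
      have : Continuous fun lam : ℝ ↦ ENNReal.ofReal (C * lam) :=
        ENNReal.continuous_ofReal.comp (by fun_prop)
      simpa using (this.tendsto 0).mono_left nhdsWithin_le_nhds
    simpa using ENNReal.Tendsto.mul_const h1 (.inr hfin.ne)
  have hlim2 : Tendsto (fun lam : ℝ ↦ K + m * lam) (𝓝[>] 0) (𝓝 K) := by
    have : Continuous fun lam : ℝ ↦ K + m * lam := by fun_prop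
    simpa using (this.tendsto 0).mono_left nhdsWithin_le_nhds
  obtain ⟨lam, ⟨⟨hlamδ, hlamK⟩, hlam1⟩, hlam0⟩ := (((hlim.eventually
    (gt_mem_nhds hδ.bot_lt)).and (hlim2.eventually (gt_mem_nhds hK))).and
    ((gt_mem_nhds (zero_lt_one' ℝ)).filter_mono nhdsWithin_le_nhds) |>.and
    (eventually_mem_nhdsWithin (s := Ioi (0 : ℝ)) (a := 0))).exists
  obtain ⟨B, c, r₀, hB, hBμ, hc, hr₀, hBd⟩ := exists_isCompact_measure_compl_lt_of_liminf_pos hld hδ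
  obtain ⟨N, S, V, hSc, hSd, hV, hflat, hSμ⟩ :=
    (flatDecomposable_of_isCompact hn hfin hunrect hc hr₀ hBd hφ1 hlam0
      hB).exists_isCompact_pairwise_disjoint hBμ
  obtain ⟨g, σ, hσ, hg, hgφ, hgS⟩ :=
    exists_approx_of_fragmentFlat hflat hSc hSd hφ hlam0 hlamK hε
  refine ⟨g, ⋃ i, S i, hg, hgφ, isCompact_iUnion hSc, hSμ, ?_⟩
  calc hausdorffContent n E (g '' ⋃ i, S i) = hausdorffContent n E (⋃ i, g '' S i) := by
        rw [image_iUnion]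
    _ ≤ ∑' i, hausdorffContent n E (g '' S i) := measure_iUnion_le _
    _ ≤ ∑' i, ENNReal.ofReal (C * lam) * μH[n] (S i) := ENNReal.tsum_le_tsum fun i ↦
        hausdorffContent_image_le_of_flat (hV i) hlam0 hlam1.le hg hσ (hgS i)
    _ = ENNReal.ofReal (C * lam) * μH[n] (⋃ i, S i) := by
        rw [ENNReal.tsum_mul_left, measure_iUnion hSd fun i ↦ (hSc i).measurableSet]
    _ ≤ ENNReal.ofReal (C * lam) * μH[n] (univ : Set X) := by gcongr; exact subset_univ _
    _ < δ := hlamδ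

/-- The `1`-Lipschitz maps whose range has small Hausdorff content contain a dense open set. -/
lemma dense_interior_setOf_hausdorffContent_range_lt [CompleteSpace X] {n : ℕ} (hn : n ≠ 0)
    (hunrect : ∀ E : Set X, IsRectifiableSet n E → μH[n] E = 0)
    (hfin : μH[n] (univ : Set X) < ∞)
    (hld : ∀ᵐ x ∂(μH[n] : Measure X),
      0 < liminf (fun r : ℝ ↦ μH[n] (closedBall x r) / ENNReal.ofReal (r ^ n)) (𝓝[>] 0))
    (m : ℕ) {δ : ℝ≥0∞} (hδ : δ ≠ 0) :
    Dense (interior {f : Lip1 X m |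
      hausdorffContent n (EuclideanSpace ℝ (Fin m)) (range f.1) < δ}) := by
  refine Metric.dense_iff.2 fun f ε hε ↦ ?_
  set R := ‖f.1‖ with hR
  have hR0 : 0 ≤ R := norm_nonneg _
  set η := min (1 / 2) (ε / (4 * (R + 1))) with hη
  have hη0 : 0 < η := by positivity
  have hη1 : η ≤ 1 / 2 := min_le_left _ _
  have hηR : η * R ≤ ε / 4 := by
    calc η * R ≤ ε / (4 * (R + 1)) * (R + 1) := by
          gcongr
          · exact min_le_right _ _
          · linarith
      _ = ε / 4 := by field_simp
  obtain ⟨g, A, hg, hgφ, hA, hAμ, hgA⟩ := exists_approx_hausdorffContent_image_lt hn hunrect hfin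
    hld (φ := fun x ↦ (1 - η) • f.1 x) (K := 1 - η) (by linarith) (fun x y ↦ by
      rw [← smul_sub, norm_smul, Real.norm_of_nonneg (by linarith)]
      have h1 := f.2.dist_le_mul x y
      rw [NNReal.coe_one, one_mul, dist_eq_norm] at h1
      exact mul_le_mul_of_nonneg_left h1 (by linarith))
    (show 0 < ε / 4 by positivity) (ENNReal.half_pos hδ).ne'
  have hgf : ∀ x, ‖g x - f.1 x‖ ≤ ε / 2 := fun x ↦ by
    have h1 := norm_add_le (g x - (1 - η) • f.1 x) (-(η • f.1 x))
    rw [norm_neg, norm_smul, Real.norm_of_nonneg hη0.le] at h1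
    have h2 : η * ‖f.1 x‖ ≤ η * R := by gcongr; exact f.1.norm_coe_le_norm x
    rw [show g x - f.1 x = g x - (1 - η) • f.1 x + -(η • f.1 x) by module]
    linarith [hgφ x]
  have hgb : ∀ x, ‖g x‖ ≤ ε / 2 + R := fun x ↦ by
    have h1 := norm_add_le (g x - f.1 x) (f.1 x)
    rw [sub_add_cancel] at h1
    linarith [hgf x, f.1.norm_coe_le_norm x]
  set G : Lip1 X m := ⟨BoundedContinuousFunction.ofNormedAddCommGroup g hg.continuous _ hgb, hg⟩
  have hGdist : ∀ F : Lip1 X m, dist F G = dist F.1 G.1 := fun F ↦ rfl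
  obtain ⟨ρ, hρ, hρ'⟩ := exists_forall_hausdorffContent_range_lt hg.continuous hA hAμ hgA
  refine ⟨G, ?_, mem_interior_iff_mem_nhds.2 (Metric.mem_nhds_iff.2 ⟨ρ, hρ, fun F hF ↦ ?_⟩)⟩
  · rw [mem_ball, dist_comm, hGdist, dist_comm]
    refine lt_of_le_of_lt ?_ (half_lt_self hε)
    refine (BoundedContinuousFunction.dist_le (by positivity)).2 fun x ↦ ?_
    rw [dist_eq_norm]
    exact hgf x
  · rw [mem_ball, hGdist] at hF
    have := hρ' F.1 F.2 fun x ↦ (BoundedContinuousFunction.dist_coe_le_dist x).trans_lt hF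
    rwa [ENNReal.add_halves] at this

lemma isRectifiableSet_zero_singleton (x : X) : IsRectifiableSet 0 ({x} : Set X) := by
  refine ⟨measurableSet_singleton x, fun _ ↦ univ, fun _ _ ↦ x, fun _ ↦ MeasurableSet.univ,
    fun _ ↦ ⟨0, (LipschitzWith.const x).lipschitzOnWith⟩, ?_⟩
  have h : ({x} : Set X) \ ⋃ _ : ℕ,
      (fun _ : EuclideanSpace ℝ (Fin 0) ↦ x) '' univ = ∅ := by
    rw [sdiff_eq_empty, singleton_subset_iff]
    exact mem_iUnion.2 ⟨0, 0, mem_univ _, rfl⟩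
  rw [h, measure_empty]

end Assembly

/-- Bate's theorem: if `X` is a complete, purely `n`-unrectifiable metric space with
`H^n(X) < ∞` and positive lower `n`-density `H^n`-a.e., then for every `m`, the set of
`f ∈ Lip_1(X, m)` with `H^n(f(X)) = 0` is residual. -/
theorem stmt2 {X : Type*} [MetricSpace X] [MeasurableSpace X] [BorelSpace X]
    [CompleteSpace X] (n : ℕ)
    (hunrect : ∀ E : Set X, IsRectifiableSet n E → μH[n] E = 0)
    (hfin : μH[n] (univ : Set X) < ∞)
    (hld : ∀ᵐ x ∂(μH[n] : Measure X),
      0 < liminf (fun r : ℝ => μH[n] (closedBall x r) / ENNReal.ofReal (r ^ n)) (𝓝[>] 0))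
    (m : ℕ) :
    {f : Lip1 X m | μH[n] (Set.range (f.1 : X → EuclideanSpace ℝ (Fin m))) = 0} ∈
      residual (Lip1 X m) := by
  rcases eq_or_ne n 0 with rfl | hn
  · have : IsEmpty X := ⟨fun x ↦ by
      have h := hunrect {x} (isRectifiableSet_zero_singleton x)
      rw [Nat.cast_zero, Measure.hausdorffMeasure_zero_singleton] at h
      exact one_ne_zero h⟩
    simp [range_eq_empty]
  have h : ⋂ k : ℕ, interior {f : Lip1 X m | hausdorffContent n (EuclideanSpace ℝ (Fin m))
      (range f.1) < ((k : ℝ≥0∞) + 1)⁻¹} ∈ residual (Lip1 X m) :=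
    countable_iInter_mem.2 fun k ↦ residual_of_dense_open isOpen_interior
      (dense_interior_setOf_hausdorffContent_range_lt hn hunrect hfin hld m (by simp))
  refine mem_of_superset h fun f hf ↦ hausdorffMeasure_eq_zero_of_hausdorffContent hn ?_
  refine nonpos_iff_eq_zero.1 (ge_of_tendsto' (ENNReal.tendsto_inv_nat_nhds_zero.comp
    (tendsto_add_atTop_nat 1)) fun k ↦ ?_)
  have := interior_subset (mem_iInter.1 hf k)
  rw [mem_ofPred_eq] at this
  simpa only [Function.comp_apply, Nat.cast_add, Nat.cast_one] using this.le
end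

section
/- Let X be a metric space and let y be a stable value of a continuous map f : X → [0,1]^n. Then y does not lie on the boundary of the cube [0,1]^n, i.e., y ∈ (0,1)^n. -/
open MeasureTheory Metric Set Filter
open scoped ENNReal NNReal Topology

/-- The unit cube `[0,1]^n` in Euclidean space. -/
def unitCube (n : ℕ) : Set (EuclideanSpace ℝ (Fin n)) :=
  {x | ∀ i, x i ∈ Set.Icc (0 : ℝ) 1}

/-- The supremum distance between two maps into Euclidean space. -/
noncomputable def supDist {X : Type*} {n : ℕ} (f g : X → EuclideanSpace ℝ (Fin n)) : ℝ :=
  ⨆ x, dist (f x) (g x)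

/-- `ε` is a stability parameter of `y` for the map `f : X → [0,1]^n`: every continuous
`g : X → [0,1]^n` at sup-distance less than `ε` from `f` attains the value `y`. -/
def IsStabilityParam {X : Type*} [MetricSpace X] {n : ℕ}
    (f : X → EuclideanSpace ℝ (Fin n)) (y : EuclideanSpace ℝ (Fin n)) (ε : ℝ) : Prop :=
  ∀ g : X → EuclideanSpace ℝ (Fin n), Continuous g → (∀ x, g x ∈ unitCube n) →
    supDist g f < ε → y ∈ Set.range g

/-- `y` is a stable value of `f : X → [0,1]^n` if it has a positive stability parameter. -/
def IsStableValue {X : Type*} [MetricSpace X] {n : ℕ}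
    (f : X → EuclideanSpace ℝ (Fin n)) (y : EuclideanSpace ℝ (Fin n)) : Prop :=
  ∃ ε > 0, IsStabilityParam f y ε

/-- A stable value of a continuous `f : X → [0,1]^n` lies in the open cube `(0,1)^n`. -/
theorem stmt3 {X : Type*} [MetricSpace X] {n : ℕ}
    (f : X → EuclideanSpace ℝ (Fin n)) (hf : Continuous f) (hfc : ∀ x, f x ∈ unitCube n)
    (y : EuclideanSpace ℝ (Fin n)) (hy : IsStableValue f y) :
    ∀ i, y i ∈ Set.Ioo (0 : ℝ) 1 := by
  intro i
  obtain ⟨ε, hε, hstab⟩ := hy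
  have ht0 : 0 < min 1 ε := lt_min one_pos hε
  have ht1 : min 1 ε ≤ 1 := min_le_left _ _
  have htε : min 1 ε ≤ ε := min_le_right _ _
  generalize min 1 ε = t at ht0 ht1 htε
  -- Push the `i`-th coordinate of `f` slightly towards the centre of the cube.
  let g : X → EuclideanSpace ℝ (Fin n) := fun x =>
    f x + EuclideanSpace.single i (t * (1 / 2 - f x i))
  have hgi (x : X) : g x i = f x i + t * (1 / 2 - f x i) := by simp [g]
  have hgi_mem (x : X) : g x i ∈ Set.Ioo (0 : ℝ) 1 := by
    obtain ⟨h0, h1⟩ := hfc x i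
    rw [hgi]
    constructor <;> nlinarith
  have hg : Continuous g := by
    have hg_eq : g = fun x =>
        f x + (t * (1 / 2 - f x i)) • EuclideanSpace.single i (1 : ℝ) := by
      funext x
      ext j
      simp [g]
    rw [hg_eq]
    fun_prop
  have hgc (x : X) : g x ∈ unitCube n := by
    intro j
    by_cases hj : j = i
    · subst hj
      exact Set.Ioo_subset_Icc_self (hgi_mem x)
    · have hgj : g x j = f x j := by simp [g, hj]
      rw [hgj]
      exact hfc x j
  have hdist : supDist g f ≤ t / 2 := by
    refine Real.iSup_le (fun x => ?_) (by positivity)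
    obtain ⟨h0, h1⟩ := hfc x i
    have hnorm : dist (g x) (f x) = |t * (1 / 2 - f x i)| := by
      simp [g, dist_eq_norm]
    rw [hnorm, abs_le]
    constructor <;> nlinarith
  obtain ⟨x, rfl⟩ := hstab g hg hgc (by linarith)
  exact hgi_mem x
end
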